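/- arXiv:0911.4672 — 16 statements merged into one kernel-verified Lean document; each statement's English description precedes it below -/
import Mathlib

section
/- Let N ≥ 1 and let A be an N×N matrix with entries in ℝ ∪ {+∞} (a minplus matrix, with +∞ playing the role of the minplus zero ε). Assume the precedence graph G(A) is strongly connected in the strong sense that for every pair of nodes i, j there is a path of length ≥ 1 from i to j all of whose edges have finite weight. Then A admits a unique finite eigenvalue λ ∈ ℝ: there exists a vector X with entries in ℝ ∪ {+∞}, not all equal to +∞, such that min_j (A_{ij} + X_j) = λ + X_i for every i; moreover, any λ' ∈ ℝ admitting such an eigenvector equals λ, and λ is the minimum over all closed paths c of G(A) of length ≥ 1 (with all edge weights finite) of the mean weight |c|_w/|c|_l, i.e. λ is the least element of the set of mean weights of closed paths. -/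
open Filter Topology

/-- The minplus product of the matrix with finite entries `B i j`, `j ∈ S i`, with a finite
vector `X`. -/
noncomputable def minplusMulVec {ι : Type*} (S : ι → Finset ι) (hS : ∀ i, (S i).Nonempty)
    (B : ι → ι → ℝ) (X : ι → ℝ) : ι → ℝ :=
  fun i => (S i).inf' (hS i) fun j => B i j + X j

section minplusMulVec

variable {ι : Type*} (S : ι → Finset ι) (hS : ∀ i, (S i).Nonempty) (B : ι → ι → ℝ)

theorem minplusMulVec_le {i j : ι} (h : j ∈ S i) (X : ι → ℝ) :
    minplusMulVec S hS B X i ≤ B i j + X j :=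
  Finset.inf'_le (fun j => B i j + X j) h

theorem minplusMulVec_le_add {X Y : ι → ℝ} {d : ℝ} (h : ∀ j, X j ≤ Y j + d) (i : ι) :
    minplusMulVec S hS B X i ≤ minplusMulVec S hS B Y i + d := by
  obtain ⟨j, hj, e⟩ := Finset.exists_mem_eq_inf' (hS i) fun j => B i j + Y j
  have h1 := minplusMulVec_le S hS B hj X
  have h2 : minplusMulVec S hS B Y i = B i j + Y j := e
  linarith [h j]

theorem minplusMulVec_add_const (X : ι → ℝ) (d : ℝ) (i : ι) :
    minplusMulVec S hS B (fun j => X j + d) i = minplusMulVec S hS B X i + d := by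
  apply le_antisymm
  · exact minplusMulVec_le_add S hS B (fun j => le_rfl) i
  · have := minplusMulVec_le_add S hS B (X := X) (Y := fun j => X j + d) (d := -d)
      (fun j => by linarith) i
    linarith

theorem lipschitzWith_minplusMulVec [Fintype ι] : LipschitzWith 1 (minplusMulVec S hS B) := by
  refine LipschitzWith.of_dist_le_mul fun X Y => ?_
  rw [NNReal.coe_one, one_mul, dist_pi_le_iff dist_nonneg]
  intro i
  have h : ∀ j, |X j - Y j| ≤ dist X Y := fun j => dist_le_pi_dist X Y j
  have h1 := minplusMulVec_le_add S hS B (X := X) (Y := Y) (d := dist X Y)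
    (fun j => by linarith [(abs_le.1 (h j)).2]) i
  have h2 := minplusMulVec_le_add S hS B (X := Y) (Y := X) (d := dist X Y)
    (fun j => by linarith [(abs_le.1 (h j)).1]) i
  rw [Real.dist_eq, abs_le]
  constructor <;> linarith

/-- The discounted fixed-point equation is solvable, with a bound on the rescaled solution. -/
theorem exists_discounted_fixedPoint [Fintype ι] {a : ℝ} (ha0 : 0 ≤ a) (ha1 : a < 1) :
    ∃ X : ι → ℝ, minplusMulVec S hS B (a • X) = X ∧
      (1 - a) * ‖X‖ ≤ ‖minplusMulVec S hS B 0‖ := by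
  have hlip := lipschitzWith_minplusMulVec S hS B
  have hK : LipschitzWith ⟨a, ha0⟩ fun X : ι → ℝ => minplusMulVec S hS B (a • X) := by
    refine LipschitzWith.of_dist_le_mul fun X Y => ?_
    refine (hlip.dist_le_mul _ _).trans ?_
    rw [NNReal.coe_one, one_mul, dist_smul₀, Real.norm_of_nonneg ha0]
    rfl
  have hc : ContractingWith ⟨a, ha0⟩ fun X : ι → ℝ => minplusMulVec S hS B (a • X) :=
    ⟨by exact_mod_cast ha1, hK⟩
  refine ⟨hc.fixedPoint _, hc.fixedPoint_isFixedPt, ?_⟩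
  set X := hc.fixedPoint _
  have hX : minplusMulVec S hS B (a • X) = X := hc.fixedPoint_isFixedPt
  have h1 := hlip.dist_le_mul (a • X) 0
  rw [hX, dist_eq_norm, dist_eq_norm, sub_zero, norm_smul, Real.norm_of_nonneg ha0,
    NNReal.coe_one, one_mul] at h1
  have h2 := norm_sub_norm_le X (minplusMulVec S hS B 0)
  linarith

/-- Existence of a finite eigenvector for an irreducible minplus matrix, by letting the discount
factor tend to `1`. -/
theorem exists_minplusMulVec_eq_add [Fintype ι] [Nonempty ι]
    (hconn : ∀ i j, Relation.ReflTransGen (fun i j => i ∈ S j) i j) :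
    ∃ (lam : ℝ) (X : ι → ℝ), ∀ i, minplusMulVec S hS B X i = lam + X i := by
  obtain ⟨r⟩ := ‹Nonempty ι›
  have hcont := (lipschitzWith_minplusMulVec S hS B).continuous
  set M := ‖minplusMulVec S hS B 0‖
  obtain ⟨K, hK⟩ : ∃ K, ∀ i j, B i j ≤ K := by
    obtain ⟨K, hK⟩ := (Set.finite_range fun p : ι × ι => B p.1 p.2).bddAbove
    exact ⟨K, fun i j => hK ⟨(i, j), rfl⟩⟩
  have hspan : ∀ i j, ∃ D : ℝ, ∀ X : ι → ℝ, (∀ k, ∀ l ∈ S k, X k ≤ X l + (K + M)) →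
      X j ≤ X i + D := by
    intro i j
    induction hconn i j with
    | refl => exact ⟨0, fun X _ => by simp⟩
    | tail _ h ih =>
      obtain ⟨D, hD⟩ := ih
      exact ⟨D + (K + M), fun X hX => by linarith [hD X hX, hX _ _ h]⟩
  choose D hD using hspan
  obtain ⟨C, hC0, hC⟩ : ∃ C, 0 ≤ C ∧ ∀ i j, D i j ≤ C := by
    obtain ⟨C, hC⟩ := (Set.finite_range fun p : ι × ι => D p.1 p.2).bddAbove
    exact ⟨max 0 C, le_max_left _ _, fun i j => le_max_of_le_right (hC ⟨(i, j), rfl⟩)⟩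
  let a : ℕ → ℝ := fun n => 1 - 1 / ((n : ℝ) + 1)
  have ha1 : ∀ n, a n < 1 := fun n => sub_lt_self _ Nat.one_div_pos_of_nat
  have ha0 : ∀ n, 0 ≤ a n := fun n => by
    have : 1 / ((n : ℝ) + 1) ≤ 1 := by
      rw [div_le_one (by positivity)]
      linarith [n.cast_nonneg (α := ℝ)]
    exact sub_nonneg.2 this
  have ha : Tendsto a atTop (𝓝 1) := by
    simpa [a] using (tendsto_one_div_add_atTop_nhds_zero_nat (𝕜 := ℝ)).const_sub 1
  choose X hX hXn using fun n => exists_discounted_fixedPoint S hS B (ha0 n) (ha1 n)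
  have hXb : ∀ n i, |(1 - a n) * X n i| ≤ M := fun n i => by
    rw [abs_mul, abs_of_nonneg (sub_nonneg.2 (ha1 n).le)]
    exact (mul_le_mul_of_nonneg_left (norm_le_pi_norm (X n) i)
      (sub_nonneg.2 (ha1 n).le)).trans (hXn n)
  have hedge : ∀ n k, ∀ l ∈ S k, X n k ≤ X n l + (K + M) := fun n k l h => by
    have h1 := minplusMulVec_le S hS B h (a n • X n)
    rw [hX n, Pi.smul_apply, smul_eq_mul] at h1
    linarith [hK k l, (abs_le.1 (hXb n l)).1]
  have hdiff : ∀ n i j, X n j ≤ X n i + C := fun n i j =>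
    (hD i j (X n) (hedge n)).trans (by linarith [hC i j])
  have hmem : ∀ n, ((fun i => X n i - X n r, (1 - a n) * X n r) : (ι → ℝ) × ℝ) ∈
      Metric.closedBall (0 : ι → ℝ) C ×ˢ Metric.closedBall (0 : ℝ) M := fun n => by
    constructor
    · rw [mem_closedBall_zero_iff, pi_norm_le_iff_of_nonneg hC0]
      intro i
      rw [Real.norm_eq_abs, abs_le]
      constructor <;> linarith [hdiff n i r, hdiff n r i]
    · rw [mem_closedBall_zero_iff]
      exact hXb n r
  obtain ⟨⟨Y, lam⟩, -, φ, hφ, hlim⟩ := ((isCompact_closedBall (0 : ι → ℝ) C).prod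
    (isCompact_closedBall (0 : ℝ) M)).tendsto_subseq hmem
  have hY : Tendsto (fun n i => X (φ n) i - X (φ n) r) atTop (𝓝 Y) :=
    (continuous_fst.tendsto _).comp hlim
  have hlam : Tendsto (fun n => (1 - a (φ n)) * X (φ n) r) atTop (𝓝 lam) :=
    (continuous_snd.tendsto _).comp hlim
  have haφ := ha.comp hφ.tendsto_atTop
  have hTY := (hcont.tendsto _).comp (haφ.smul hY)
  rw [one_smul] at hTY
  refine ⟨lam, Y, fun i => tendsto_nhds_unique ((continuous_apply i).tendsto _ |>.comp hTY) ?_⟩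
  refine (hlam.add ((continuous_apply i).tendsto _ |>.comp hY)).congr fun n => ?_
  have h1 := minplusMulVec_add_const S hS B
    (a (φ n) • fun i => X (φ n) i - X (φ n) r) (a (φ n) * X (φ n) r) i
  have h2 : (fun j => (a (φ n) • fun i => X (φ n) i - X (φ n) r) j + a (φ n) * X (φ n) r) =
      a (φ n) • X (φ n) := by
    ext j
    simp only [Pi.smul_apply, smul_eq_mul]
    ring
  rw [h2, hX] at h1
  simp only [Function.comp_apply]
  linarith

end minplusMulVec

section Eigenvector

variable {ι : Type*} [Fintype ι] {A : ι → ι → WithTop ℝ} {lam : ℝ}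

/-- Every eigenvector of an irreducible minplus matrix is finite. -/
theorem minplus_eigenvector_ne_top
    (hconn : ∀ i j : ι, ∃ L : ℕ, 1 ≤ L ∧ ∃ c : ℕ → ι,
      c 0 = i ∧ c L = j ∧ ∀ t < L, A (c (t + 1)) (c t) ≠ ⊤)
    {X : ι → WithTop ℝ} (hX : ∃ i, X i ≠ ⊤)
    (h : ∀ i, Finset.univ.inf (fun j => A i j + X j) = (lam : WithTop ℝ) + X i) (i : ι) :
    X i ≠ ⊤ := by
  obtain ⟨k, hk⟩ := hX
  obtain ⟨L, -, c, rfl, rfl, hc⟩ := hconn k i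
  have key : ∀ t ≤ L, X (c t) ≠ ⊤ := by
    intro t
    induction t with
    | zero => exact fun _ => hk
    | succ t ih =>
      intro ht htop
      have h1 := h (c (t + 1))
      rw [htop, WithTop.add_top, Finset.inf_eq_top_iff] at h1
      exact WithTop.add_ne_top.2 ⟨hc t ht, ih (by lia)⟩ (h1 (c t) (Finset.mem_univ _))
  exact key L le_rfl

/-- An eigenvalue with a finite eigenvector is the least mean weight of closed paths. -/
theorem isLeast_mean_weight_of_eigenvector [Nonempty ι] {x : ι → ℝ}
    (h : ∀ i, Finset.univ.inf (fun j => A i j + (x j : WithTop ℝ)) = (lam : WithTop ℝ) + x i) :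
    IsLeast
      { mu : ℝ | ∃ L : ℕ, 1 ≤ L ∧ ∃ c : ℕ → ι,
          c L = c 0 ∧ (∀ t < L, A (c (t + 1)) (c t) ≠ ⊤) ∧
          (∑ t ∈ Finset.range L, A (c (t + 1)) (c t)) = ((((L : ℝ) * mu) : ℝ) : WithTop ℝ) }
      lam := by
  have hsum : ∀ (c : ℕ → ι) (L : ℕ), c L = c 0 →
      ∑ t ∈ Finset.range L, (lam + (x (c (t + 1)) - x (c t))) = L * lam := fun c L hc => by
    rw [Finset.sum_add_distrib, Finset.sum_range_sub fun t => x (c t), hc]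
    simp
  constructor
  · have hp : ∀ i, ∃ j, A i j = ((lam + (x i - x j) : ℝ) : WithTop ℝ) := by
      intro i
      obtain ⟨j, -, hj⟩ := Finset.exists_mem_eq_inf Finset.univ Finset.univ_nonempty
        fun j => A i j + (x j : WithTop ℝ)
      rw [h i] at hj
      refine ⟨j, ?_⟩
      cases hA : A i j with
      | top => rw [hA] at hj; simp [← WithTop.coe_add] at hj
      | coe b =>
        rw [hA] at hj
        norm_cast at hj ⊢
        linarith
    choose p hp using hp
    obtain ⟨r⟩ := ‹Nonempty ι›
    obtain ⟨m, n, hmn, e⟩ : ∃ m n, m < n ∧ p^[m] r = p^[n] r := by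
      obtain ⟨m, n, hne, e⟩ := Finite.exists_ne_map_eq_of_infinite fun n => p^[n] r
      rcases hne.lt_or_gt with h | h
      · exact ⟨m, n, h, e⟩
      · exact ⟨n, m, h, e.symm⟩
    have hc : p^[n - (n - m)] r = p^[n - 0] r := by
      rw [Nat.sub_sub_self hmn.le, e, Nat.sub_zero]
    have hA : ∀ t < n - m, A (p^[n - (t + 1)] r) (p^[n - t] r) =
        ((lam + (x (p^[n - (t + 1)] r) - x (p^[n - t] r)) : ℝ) : WithTop ℝ) := by
      intro t ht
      have e1 : n - t = (n - (t + 1)) + 1 := by lia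
      rw [e1, Function.iterate_succ_apply']
      exact hp _
    refine ⟨n - m, by lia, fun t => p^[n - t] r, hc, fun t ht => ?_, ?_⟩
    · rw [hA t ht]
      exact WithTop.coe_ne_top
    · rw [Finset.sum_congr rfl fun t ht => hA t (Finset.mem_range.1 ht), ← WithTop.coe_sum,
        hsum (fun t => p^[n - t] r) _ hc]
  · rintro mu ⟨L, hL, c, hc, -, hmu⟩
    have hle : ∀ t, ((lam + (x (c (t + 1)) - x (c t)) : ℝ) : WithTop ℝ) ≤
        A (c (t + 1)) (c t) := by
      intro t
      have h1 : (lam : WithTop ℝ) + x (c (t + 1)) ≤ A (c (t + 1)) (c t) + x (c t) :=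
        (h (c (t + 1))).symm.trans_le
          (Finset.inf_le (f := fun j => A (c (t + 1)) j + (x j : WithTop ℝ)) (Finset.mem_univ _))
      cases hA : A (c (t + 1)) (c t) with
      | top => exact le_top
      | coe b =>
        rw [hA] at h1
        norm_cast at h1 ⊢
        linarith
    have h2 := Finset.sum_le_sum fun t (_ : t ∈ Finset.range L) => hle t
    rw [hmu, ← WithTop.coe_sum, hsum c L hc, WithTop.coe_le_coe] at h2
    exact le_of_mul_le_mul_left h2 (by exact_mod_cast hL)

end Eigenvector

/-- A strongly connected minplus matrix (entries in ℝ ∪ {+∞}) admits a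
unique finite eigenvalue λ, which is the least mean weight of closed paths. -/
theorem minplus_eigenvalue_unique
    (N : ℕ) (hN : 1 ≤ N) (A : Fin N → Fin N → WithTop ℝ)
    (hconn : ∀ i j : Fin N, ∃ L : ℕ, 1 ≤ L ∧ ∃ c : ℕ → Fin N,
      c 0 = i ∧ c L = j ∧ ∀ t < L, A (c (t + 1)) (c t) ≠ ⊤) :
    ∃ lam : ℝ,
      (∃ X : Fin N → WithTop ℝ, (∃ i, X i ≠ ⊤) ∧
        ∀ i, Finset.univ.inf (fun j => A i j + X j) = (lam : WithTop ℝ) + X i) ∧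
      (∀ lam' : ℝ,
        (∃ X : Fin N → WithTop ℝ, (∃ i, X i ≠ ⊤) ∧
          ∀ i, Finset.univ.inf (fun j => A i j + X j) = (lam' : WithTop ℝ) + X i) →
        lam' = lam) ∧
      IsLeast
        { mu : ℝ | ∃ L : ℕ, 1 ≤ L ∧ ∃ c : ℕ → Fin N,
            c L = c 0 ∧ (∀ t < L, A (c (t + 1)) (c t) ≠ ⊤) ∧
            (∑ t ∈ Finset.range L, A (c (t + 1)) (c t)) = ((((L : ℝ) * mu) : ℝ) : WithTop ℝ) }
        lam := by
  have : Nonempty (Fin N) := ⟨⟨0, hN⟩⟩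
  have hleast : ∀ mu : ℝ, (∃ X : Fin N → WithTop ℝ, (∃ i, X i ≠ ⊤) ∧
      ∀ i, Finset.univ.inf (fun j => A i j + X j) = (mu : WithTop ℝ) + X i) →
      IsLeast
        { mu : ℝ | ∃ L : ℕ, 1 ≤ L ∧ ∃ c : ℕ → Fin N,
            c L = c 0 ∧ (∀ t < L, A (c (t + 1)) (c t) ≠ ⊤) ∧
            (∑ t ∈ Finset.range L, A (c (t + 1)) (c t)) = ((((L : ℝ) * mu) : ℝ) : WithTop ℝ) }
        mu := by
    rintro mu ⟨X, hX, h⟩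
    lift X to Fin N → ℝ using minplus_eigenvector_ne_top hconn hX h
    exact isLeast_mean_weight_of_eigenvector h
  let S : Fin N → Finset (Fin N) := fun i => {j | A i j ≠ ⊤}
  have hS : ∀ i, (S i).Nonempty := fun i => by
    obtain ⟨L, hL, c, -, rfl, hc⟩ := hconn i i
    obtain ⟨L, rfl⟩ := Nat.exists_eq_add_of_le' hL
    exact ⟨c L, Finset.mem_filter.2 ⟨Finset.mem_univ _, hc L (Nat.lt_succ_self L)⟩⟩
  have hpath : ∀ i j, Relation.ReflTransGen (fun i j => i ∈ S j) i j := fun i j => by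
    obtain ⟨L, -, c, rfl, rfl, hc⟩ := hconn i j
    have key : ∀ t ≤ L, Relation.ReflTransGen (fun i j => i ∈ S j) (c 0) (c t) := by
      intro t
      induction t with
      | zero => exact fun _ => .refl
      | succ t ih =>
        exact fun ht => (ih (by lia)).tail (Finset.mem_filter.2 ⟨Finset.mem_univ _, hc t ht⟩)
    exact key L le_rfl
  obtain ⟨lam, x, hx⟩ := exists_minplusMulVec_eq_add S hS (fun i j => (A i j).untopD 0) hpath
  have hB : ∀ i, ∀ j ∈ S i,
      (((A i j).untopD 0 + x j : ℝ) : WithTop ℝ) = A i j + (x j : WithTop ℝ) := fun i j hj => by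
    obtain ⟨b, hb⟩ := WithTop.ne_top_iff_exists.1 (Finset.mem_filter.1 hj).2
    rw [← hb, WithTop.untopD_coe, WithTop.coe_add]
  have hlam : ∃ X : Fin N → WithTop ℝ, (∃ i, X i ≠ ⊤) ∧
      ∀ i, Finset.univ.inf (fun j => A i j + X j) = (lam : WithTop ℝ) + X i := by
    refine ⟨fun i => x i, ⟨⟨0, hN⟩, WithTop.coe_ne_top⟩, fun i => ?_⟩
    rw [← WithTop.coe_add, ← hx i]
    apply le_antisymm
    · obtain ⟨j, hj, e⟩ := Finset.exists_mem_eq_inf' (hS i) fun j => (A i j).untopD 0 + x j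
      rw [minplusMulVec, e, hB i j hj]
      exact Finset.inf_le (f := fun j => A i j + (x j : WithTop ℝ)) (Finset.mem_univ j)
    · refine Finset.le_inf fun j _ => ?_
      by_cases hj : A i j = ⊤
      · simp [hj]
      · have hj' : j ∈ S i := Finset.mem_filter.2 ⟨Finset.mem_univ _, hj⟩
        rw [← hB i j hj', WithTop.coe_le_coe]
        exact minplusMulVec_le S hS _ hj' x
  exact ⟨lam, hlam, fun mu hmu => (hleast mu hmu).unique (hleast lam hlam), hleast lam hlam⟩
end

section
/- Let m ≥ 2 and let c : ZMod m → Bool be an initial configuration of cars on a circular road with m sections, with n = card{i : c(i) = true} occupied sections. Let F be the one-step update applying the rule 10 → 01 simultaneously: (F c)(i) = (c(i) ∧ c(i+1)) ∨ (c(i−1) ∧ ¬c(i)). Then there exists T such that for all t ≥ T, the number of cars that move at step t equals min(n, m − n); that is, card{i : (F^[t] c)(i) = true ∧ (F^[t] c)(i+1) = false} = min(n, m − n). Equivalently, the asymptotic flow φ equals ρ if ρ ≤ 1/2 and 1 − ρ if ρ ≥ 1/2, where ρ = n/m. -/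
/-- One step of the exclusion-process dynamics (rule 10 → 01) on a circular road
with `m` sections: a section is occupied after the step iff it was occupied with
the section ahead also occupied, or it was free with the section behind occupied. -/
def exclusionStep (m : ℕ) (c : ZMod m → Bool) : ZMod m → Bool :=
  fun i => (c i && c (i + 1)) || (c (i - 1) && !(c i))

/-- The height function of a configuration along the lifted road: it goes down by one over each
occupied section and up by one over each free section. -/
def exclusionHeight (m : ℕ) (c : ZMod m → Bool) (x : ℕ) : ℤ :=
  ∑ j ∈ Finset.range x, if c (j : ZMod m) then -1 else 1

/-- The height function after `t` steps, in a frame moving one section forward per step. -/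
def evolvedHeight (f : ℕ → ℤ) : ℕ → ℕ → ℤ
  | 0, x => f x
  | t + 1, x => min (evolvedHeight f t x) (evolvedHeight f t (x + 2))

theorem evolvedHeight_le (f : ℕ → ℤ) (t : ℕ) :
    ∀ x k, k ≤ t → evolvedHeight f t x ≤ f (x + 2 * k) := by
  induction t with
  | zero =>
    intro x k hk
    obtain rfl : k = 0 := by omega
    simp [evolvedHeight]
  | succ t ih =>
    intro x k hk
    rw [evolvedHeight]
    rcases Nat.lt_or_ge t k with h | h
    · obtain rfl : k = t + 1 := by omega
      have := ih (x + 2) t le_rfl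
      rw [show x + 2 * (t + 1) = x + 2 + 2 * t by ring]
      exact (min_le_right _ _).trans this
    · exact (min_le_left _ _).trans (ih x k h)

theorem exists_evolvedHeight_eq (f : ℕ → ℤ) (t : ℕ) :
    ∀ x, ∃ k ≤ t, evolvedHeight f t x = f (x + 2 * k) := by
  induction t with
  | zero => exact fun x => ⟨0, le_rfl, rfl⟩
  | succ t ih =>
    intro x
    rw [evolvedHeight]
    rcases min_choice (evolvedHeight f t x) (evolvedHeight f t (x + 2)) with h | h
    · obtain ⟨k, hk, e⟩ := ih x
      exact ⟨k, by omega, h.trans e⟩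
    · obtain ⟨k, hk, e⟩ := ih (x + 2)
      exact ⟨k + 1, by omega, by rw [h, e]; congr 1; ring⟩

theorem evolvedHeight_exclusionHeight_succ (m : ℕ) (c : ZMod m → Bool) (t : ℕ) :
    ∀ x, evolvedHeight (exclusionHeight m c) t (x + 1) =
      evolvedHeight (exclusionHeight m c) t x +
        if ((exclusionStep m)^[t] c) ((x + t : ℕ) : ZMod m) then -1 else 1 := by
  induction t with
  | zero =>
    intro x
    simp [evolvedHeight, exclusionHeight, Finset.sum_range_succ]
  | succ t ih =>
    intro x
    have h0 := ih x
    have h1 := ih (x + 1)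
    have h2 := ih (x + 2)
    rw [Function.iterate_succ_apply']
    generalize (exclusionStep m)^[t] c = d at *
    have e1 : ((x + (t + 1) : ℕ) : ZMod m) - 1 = ((x + t : ℕ) : ZMod m) := by push_cast; ring
    have e2 : ((x + (t + 1) : ℕ) : ZMod m) + 1 = ((x + 2 + t : ℕ) : ZMod m) := by
      push_cast; ring
    have e3 : ((x + 1 + t : ℕ) : ZMod m) = ((x + (t + 1) : ℕ) : ZMod m) := by push_cast; ring
    simp only [evolvedHeight, exclusionStep, e1, e2]
    rw [e3] at h1
    rw [show x + 1 + 2 = x + 2 + 1 by ring]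
    rw [show x + 1 + 1 = x + 2 by ring] at h1
    cases ha : d ((x + t : ℕ) : ZMod m) <;> cases hb : d ((x + (t + 1) : ℕ) : ZMod m) <;>
      cases hd : d ((x + 2 + t : ℕ) : ZMod m) <;> simp [ha, hb, hd, -Nat.cast_add] at h0 h1 h2 ⊢ <;> omega

theorem ZMod.sum_range_natCast {M : Type*} [AddCommMonoid M] (m : ℕ) [NeZero m]
    (g : ZMod m → M) : ∑ j ∈ Finset.range m, g (j : ZMod m) = ∑ i, g i := by
  refine Finset.sum_bij' (fun j _ => (j : ZMod m)) (fun i _ => i.val) ?_ ?_ ?_ ?_ ?_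
  · simp
  · simp [ZMod.val_lt]
  · intro j hj
    exact ZMod.val_cast_of_lt (Finset.mem_range.mp hj)
  · simp
  · simp

theorem exclusionHeight_add_period (m : ℕ) [NeZero m] (c : ZMod m → Bool) (x : ℕ) :
    exclusionHeight m c (x + m) = exclusionHeight m c x +
      (m - 2 * (Finset.univ.filter fun i => c i = true).card) := by
  have h := ZMod.sum_range_natCast m fun i => if c i then (-1 : ℤ) else 1
  have h' : ∑ i, (if c i then (-1 : ℤ) else 1) =
      m - 2 * (Finset.univ.filter fun i => c i = true).card := by
    have : ∀ i, (if c i then (-1 : ℤ) else 1) = 1 - 2 * (if c i = true then 1 else 0) := by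
      intro i; split_ifs <;> rfl
    simp only [this, Finset.sum_sub_distrib, ← Finset.mul_sum, Finset.sum_boole]
    simp [ZMod.card]
  rw [exclusionHeight, add_comm x m, Finset.sum_range_add, h, h', add_comm]
  simp [exclusionHeight]

theorem card_exclusionStep (m : ℕ) [NeZero m] (c : ZMod m → Bool) :
    (Finset.univ.filter fun i => exclusionStep m c i = true).card =
      (Finset.univ.filter fun i => c i = true).card := by
  have shift := Equiv.sum_comp (Equiv.subRight (1 : ZMod m))
    fun i => if c i = true ∧ c (i + 1) = false then 1 else 0
  simp only [Equiv.subRight_apply, sub_add_cancel] at shift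
  have h : ∀ i, (if exclusionStep m c i = true then 1 else 0) =
      (if c i = true ∧ c (i + 1) = true then 1 else 0) +
        if c (i - 1) = true ∧ c i = false then 1 else 0 := by
    intro i
    cases h1 : c i <;> cases h2 : c (i - 1) <;> cases h3 : c (i + 1) <;>
      simp [exclusionStep, h1, h2, h3]
  rw [Finset.card_filter, Finset.card_filter, Finset.sum_congr rfl fun i _ => h i,
    Finset.sum_add_distrib, shift, ← Finset.sum_add_distrib]
  refine Finset.sum_congr rfl fun i _ => ?_
  cases c i <;> cases c (i + 1) <;> rfl

theorem card_exclusionStep_iterate (m : ℕ) [NeZero m] (c : ZMod m → Bool) (t : ℕ) :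
    (Finset.univ.filter fun i => ((exclusionStep m)^[t] c) i = true).card =
      (Finset.univ.filter fun i => c i = true).card := by
  induction t with
  | zero => rfl
  | succ t ih => rw [Function.iterate_succ_apply', card_exclusionStep, ih]

theorem evolvedHeight_add_two (m : ℕ) (c : ZMod m → Bool) (t x : ℕ) :
    evolvedHeight (exclusionHeight m c) t (x + 2) =
      evolvedHeight (exclusionHeight m c) t x +
        (if ((exclusionStep m)^[t] c) ((x + t : ℕ) : ZMod m) then -1 else 1) +
        if ((exclusionStep m)^[t] c) ((x + t : ℕ) + 1 : ZMod m) then -1 else 1 := by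
  rw [← Nat.cast_succ, Nat.succ_eq_add_one, show x + t + 1 = x + 1 + t by ring,
    ← evolvedHeight_exclusionHeight_succ, ← evolvedHeight_exclusionHeight_succ]

theorem evolvedHeight_le_add_two {f : ℕ → ℤ} {p t : ℕ} (hp : 0 < p) (hf : ∀ x, f x ≤ f (x + 2 * p))
    (ht : p ≤ t + 1) (x : ℕ) : evolvedHeight f t x ≤ evolvedHeight f t (x + 2) := by
  obtain ⟨k, hk, e⟩ := exists_evolvedHeight_eq f t (x + 2)
  rw [e]
  rcases hk.lt_or_eq with h | rfl
  · convert evolvedHeight_le f t x (k + 1) (by omega) using 2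
    ring
  · refine (evolvedHeight_le f k x (k + 1 - p) (by omega)).trans ((hf _).trans_eq ?_)
    congr 1; omega

theorem evolvedHeight_add_two_le {f : ℕ → ℤ} {p t : ℕ} (hp : 0 < p) (hf : ∀ x, f (x + 2 * p) ≤ f x)
    (ht : p ≤ t + 1) (x : ℕ) : evolvedHeight f t (x + 2) ≤ evolvedHeight f t x := by
  obtain ⟨k, hk, e⟩ := exists_evolvedHeight_eq f t x
  rw [e]
  rcases Nat.eq_zero_or_pos k with rfl | h
  · refine (evolvedHeight_le f t (x + 2) (p - 1) (by omega)).trans (le_of_eq_of_le ?_ (hf _))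
    congr 1; omega
  · convert evolvedHeight_le f t (x + 2) (k - 1) (by omega) using 2
    omega

theorem ZMod.exists_natCast_add_eq (m : ℕ) [NeZero m] (t : ℕ) (i : ZMod m) :
    ∃ x : ℕ, ((x + t : ℕ) : ZMod m) = i :=
  ⟨(i - t).val, by simp⟩

/-- after a finite transient, the number of cars that move at each
step equals `min n (m - n)` where `n` is the number of cars. -/
theorem exclusion_asymptotic_flow (m : ℕ) [NeZero m] (hm : 2 ≤ m)
    (c : ZMod m → Bool) :
    ∃ T : ℕ, ∀ t ≥ T,
      (Finset.univ.filter fun i : ZMod m =>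
          ((exclusionStep m)^[t] c) i = true ∧ ((exclusionStep m)^[t] c) (i + 1) = false).card
        = min ((Finset.univ.filter fun i : ZMod m => c i = true).card)
            (m - (Finset.univ.filter fun i : ZMod m => c i = true).card) := by
  refine ⟨m, fun t ht => ?_⟩
  have hm0 : 0 < m := by omega
  have hper : ∀ x, exclusionHeight m c (x + 2 * m) = exclusionHeight m c x +
      2 * (m - 2 * (Finset.univ.filter fun i => c i = true).card) := by
    intro x
    rw [show x + 2 * m = x + m + m by ring, exclusionHeight_add_period,
      exclusionHeight_add_period]
    ring
  have hcard := card_exclusionStep_iterate m c t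
  have hstep := evolvedHeight_add_two m c t
  rcases le_total (2 * (Finset.univ.filter fun i => c i = true).card) m with h | h
  · have no_pair : ∀ i, ((exclusionStep m)^[t] c) i = true →
        ((exclusionStep m)^[t] c) (i + 1) = false := by
      intro i hi
      obtain ⟨x, rfl⟩ := ZMod.exists_natCast_add_eq m t i
      have hle := evolvedHeight_le_add_two (f := exclusionHeight m c) hm0
        (fun x => by rw [hper]; omega) (by omega : m ≤ t + 1) x
      by_contra hne
      rw [Bool.not_eq_false] at hne
      simp only [hstep, hi, hne, if_true] at hle
      omega
    rw [min_eq_left (by omega), ← hcard]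
    congr 1
    ext i
    simpa using no_pair i
  · have no_gap : ∀ i, ((exclusionStep m)^[t] c) (i + 1) = false →
        ((exclusionStep m)^[t] c) i = true := by
      intro i hi
      obtain ⟨x, rfl⟩ := ZMod.exists_natCast_add_eq m t i
      have hle := evolvedHeight_add_two_le (f := exclusionHeight m c) hm0
        (fun x => by rw [hper]; omega) (by omega : m ≤ t + 1) x
      by_contra hne
      rw [Bool.not_eq_true] at hne
      simp only [hstep, hi, hne, Bool.false_eq_true, if_false] at hle
      omega
    rw [min_eq_right (by omega), ← hcard]
    have hsplit := Finset.card_filter_add_card_filter_not (s := Finset.univ)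
      (fun i => ((exclusionStep m)^[t] c) i = true)
    rw [Finset.card_univ, ZMod.card] at hsplit
    rw [← Nat.eq_sub_of_add_eq' hsplit]
    refine Finset.card_equiv (Equiv.addRight 1) fun i => ?_
    simpa using no_gap i
end

section
/- Let m ≥ 2, let a : ZMod m → ℝ take values in {0,1} with ∑_s a(s) = n (a(s) = 1 meaning section s initially contains a vehicle), and consider the minplus linear dynamics on q : ZMod m → ℝ given by q^{k+1}_s = min(a(s−1) + q^k_{s−1}, (1 − a(s)) + q^k_{s+1}). Then for every initial vector q^0 ∈ ℝ^{ZMod m} and every section s, the limit lim_{k→∞} q^k_s / k exists and equals min(n, m − n)/m = min(ρ, 1 − ρ), where ρ = n/m. -/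
open Filter

/-- One step of the minplus linear (event graph) dynamics of the circular road:
`q^{k+1}_s = min(a_{s-1} + q^k_{s-1}, (1 - a_s) + q^k_{s+1})`. -/
noncomputable def roadStep (m : ℕ) (a : ZMod m → ℝ) (q : ZMod m → ℝ) : ZMod m → ℝ :=
  fun s => min (a (s - 1) + q (s - 1)) ((1 - a s) + q (s + 1))

/-- A function on `ZMod m` whose values sum to zero is the discrete derivative of a potential. -/
theorem exists_potential_of_sum_eq_zero (m : ℕ) [NeZero m] (g : ZMod m → ℝ)
    (hg : ∑ s, g s = 0) : ∃ v : ZMod m → ℝ, ∀ s, v (s + 1) = v s + g s := by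
  set f : ℕ → ℝ := fun k => ∑ i ∈ Finset.range k, g (i : ZMod m) with hf
  have hfm : f m = 0 := by
    rw [← hg]
    refine Finset.sum_bij' (fun i _ => (i : ZMod m)) (fun s _ => s.val) ?_ ?_ ?_ ?_ ?_
    · simp
    · intro s _
      simpa using ZMod.val_lt s
    · intro i hi
      exact ZMod.val_cast_of_lt (Finset.mem_range.1 hi)
    · simp
    · simp
  have hper : Function.Periodic f m := by
    intro k
    have h : f (m + k) = f m + f k := by
      simp [hf, Finset.sum_range_add]
    rw [add_comm k m, h, hfm, zero_add]
  refine ⟨fun s => f s.val, fun s => ?_⟩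
  have hval : (s + 1).val = (s.val + 1) % m := by
    rw [← ZMod.val_natCast]
    simp
  simp only [hval, hper.map_mod_nat]
  simp [hf, Finset.sum_range_succ]

/-- A potential with increments `a - ρ` is an additive eigenvector of the road dynamics. -/
theorem roadStep_eigenvector (m : ℕ) (a v : ZMod m → ℝ) (ρ : ℝ)
    (hv : ∀ s, v (s + 1) = v s + (a s - ρ)) (s : ZMod m) :
    roadStep m a v s = v s + min ρ (1 - ρ) := by
  have h := hv (s - 1)
  rw [sub_add_cancel] at h
  rw [roadStep, hv s, ← min_add_add_left]
  congr 1 <;> linarith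

/-- The road dynamics is nonexpansive along an additive eigenvector. -/
theorem abs_roadStep_iterate_sub_le (m : ℕ) (a v q : ZMod m → ℝ) (l C : ℝ)
    (hv : ∀ s, roadStep m a v s = v s + l) (hq : ∀ s, |q s - v s| ≤ C) (k : ℕ) (s : ZMod m) :
    |(roadStep m a)^[k] q s - (v s + k * l)| ≤ C := by
  induction k generalizing s with
  | zero => simpa using hq s
  | succ k ih =>
    have h1 := ih (s - 1)
    have h2 := ih (s + 1)
    have h : v s + ((k + 1 : ℕ) : ℝ) * l
        = min (a (s - 1) + (v (s - 1) + k * l)) ((1 - a s) + (v (s + 1) + k * l)) := by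
      rw [← add_assoc, ← add_assoc, min_add_add_right]
      change _ = roadStep m a v s + k * l
      rw [hv]
      push_cast
      ring
    rw [Function.iterate_succ_apply', roadStep, h]
    refine (abs_min_sub_min_le_max _ _ _ _).trans (max_le ?_ ?_)
    · rwa [add_sub_add_left_eq_sub]
    · rwa [add_sub_add_left_eq_sub]

/-- A sequence at bounded distance from `k * l` has growth rate `l`. -/
theorem tendsto_div_of_abs_sub_le (u : ℕ → ℝ) (b l C : ℝ)
    (h : ∀ k : ℕ, |u k - (b + k * l)| ≤ C) :
    Tendsto (fun k : ℕ => u k / k) atTop (nhds l) := by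
  rw [tendsto_iff_dist_tendsto_zero]
  refine squeeze_zero' (Eventually.of_forall fun _ => dist_nonneg) ?_
    (tendsto_const_div_atTop_nhds_zero_nat (C + |b|))
  filter_upwards [eventually_gt_atTop 0] with k hk
  have hk' : (0 : ℝ) < k := Nat.cast_pos.2 hk
  rw [Real.dist_eq, div_sub' hk'.ne', abs_div, abs_of_pos hk']
  gcongr
  calc |u k - k * l| = |(u k - (b + k * l)) + b| := by ring_nf
    _ ≤ |u k - (b + k * l)| + |b| := abs_add_le _ _
    _ ≤ C + |b| := by gcongr; exact h k

/-- for any initial vector, the growth rate of every coordinate of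
the minplus road dynamics exists and equals `min(n, m - n)/m = min(ρ, 1-ρ)`. -/
theorem road_growth_rate (m : ℕ) [NeZero m] (hm : 2 ≤ m)
    (a : ZMod m → ℝ) (ha : ∀ s, a s = 0 ∨ a s = 1)
    (n : ℕ) (hn : ∑ s : ZMod m, a s = n)
    (q0 : ZMod m → ℝ) (s : ZMod m) :
    Tendsto (fun k : ℕ => ((roadStep m a)^[k] q0) s / k) atTop
      (nhds (min (n : ℝ) ((m : ℝ) - (n : ℝ)) / (m : ℝ))) := by
  have hm0 : (0 : ℝ) < m := by positivity
  obtain ⟨v, hv⟩ := exists_potential_of_sum_eq_zero m (fun s => a s - (n : ℝ) / m) (by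
    rw [Finset.sum_sub_distrib, hn]
    simp [mul_div_cancel₀, hm0.ne'])
  have hl : min (n : ℝ) ((m : ℝ) - n) / m = min ((n : ℝ) / m) (1 - (n : ℝ) / m) := by
    rw [← min_div_div_right hm0.le, sub_div, div_self hm0.ne']
  rw [hl]
  refine tendsto_div_of_abs_sub_le _ (v s) _ (∑ t, |q0 t - v t|) fun k => ?_
  exact abs_roadStep_iterate_sub_le m a v q0 _ _ (roadStep_eigenvector m a v _ hv)
    (fun t => Finset.single_le_sum (f := fun t => |q0 t - v t|)
      (fun _ _ => abs_nonneg _) (Finset.mem_univ t)) k s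
end

section
/- Let d ≥ 2 and let f : ℝ^d → ℝ^d be continuous and additively homogeneous of degree 1, i.e. f(x + c·𝟙) = f(x) + c·𝟙 for every x ∈ ℝ^d and c ∈ ℝ, where 𝟙 = (1,…,1). Define the induced quotient map g : ℝ^{d−1} → ℝ^{d−1} by g(y)_j = f(ŷ)_{j+1} − f(ŷ)_1 for j = 1,…,d−1, where ŷ = (0, y_1, …, y_{d−1}), and define h : ℝ^{d−1} → ℝ by h(y) = f(ŷ)_1. Suppose x^0 ∈ ℝ^d is such that the differences x^k_j − x^k_1 of the trajectory x^{k+1} = f(x^k) stay bounded over all j and k. Then there exists a Borel probability measure Q on ℝ^{d−1}, invariant under g, such that for Q-almost every y, the growth rate lim_{N→∞} (1/N) ∑_{k=0}^{N−1} h(g^[k](y)) exists; equivalently, for Q-almost every y the trajectory started at ŷ satisfies that lim_N x^N_1/N exists. -/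
open MeasureTheory Filter

/-- `hatv d y = ŷ = (0, y₁, …, y_{d-1})`. -/
noncomputable def hatv (d : ℕ) (y : Fin (d - 1) → ℝ) : Fin d → ℝ :=
  fun i => if h : (i : ℕ) = 0 then 0 else y ⟨(i : ℕ) - 1, by have hi := i.isLt; omega⟩

/-- The quotient map `g(y)_j = f(ŷ)_{j+1} - f(ŷ)_1` induced by an additively
1-homogeneous map `f`. -/
noncomputable def quotG (d : ℕ) (f : (Fin d → ℝ) → Fin d → ℝ)
    (y : Fin (d - 1) → ℝ) : Fin (d - 1) → ℝ :=
  fun j => f (hatv d y) ⟨(j : ℕ) + 1, by have hj := j.isLt; omega⟩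
    - f (hatv d y) ⟨0, by have hj := j.isLt; omega⟩

/-- The one-step increment of the first coordinate: `h(y) = f(ŷ)_1`. -/
noncomputable def quotH (d : ℕ) (f : (Fin d → ℝ) → Fin d → ℝ)
    (y : Fin (d - 1) → ℝ) : ℝ :=
  if h : 0 < d then f (hatv d y) ⟨0, h⟩ else 0

/-- The running maximum of `0` and the Birkhoff sums `birkhoffSum T f k` with `k ≤ n`,
defined recursively. -/
noncomputable def maxBirkhoffSum {α : Type*} (T : α → α) (f : α → ℝ) : ℕ → α → ℝ
  | 0 => fun _ => 0
  | n + 1 => fun x => max 0 (f x + maxBirkhoffSum T f n (T x))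

section Maximal

variable {α : Type*} {T : α → α} {f : α → ℝ}

theorem maxBirkhoffSum_nonneg (n : ℕ) (x : α) : 0 ≤ maxBirkhoffSum T f n x := by
  cases n with
  | zero => exact le_rfl
  | succ n => exact le_max_left _ _

theorem maxBirkhoffSum_le_succ (n : ℕ) (x : α) :
    maxBirkhoffSum T f n x ≤ maxBirkhoffSum T f (n + 1) x := by
  induction n generalizing x with
  | zero => exact maxBirkhoffSum_nonneg 1 x
  | succ n ih => exact max_le_max le_rfl (by linarith [ih (T x)])

theorem maxBirkhoffSum_mono (x : α) : Monotone fun n => maxBirkhoffSum T f n x :=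
  monotone_nat_of_le_succ fun n => maxBirkhoffSum_le_succ n x

theorem birkhoffSum_le_maxBirkhoffSum (n : ℕ) (x : α) :
    birkhoffSum T f n x ≤ maxBirkhoffSum T f n x := by
  induction n generalizing x with
  | zero => simp [maxBirkhoffSum]
  | succ n ih =>
    rw [birkhoffSum_succ']
    exact le_max_of_le_right (by linarith [ih (T x)])

theorem maxBirkhoffSum_sub_le_indicator (n : ℕ) (x : α) :
    maxBirkhoffSum T f n x - maxBirkhoffSum T f n (T x) ≤
      {y | 0 < maxBirkhoffSum T f n y}.indicator f x := by
  by_cases hx : 0 < maxBirkhoffSum T f n x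
  · rw [Set.indicator_of_mem (by exact hx)]
    cases n with
    | zero => exact absurd hx (lt_irrefl _)
    | succ n =>
      have h1 : maxBirkhoffSum T f (n + 1) x = max 0 (f x + maxBirkhoffSum T f n (T x)) := rfl
      have h2 := maxBirkhoffSum_le_succ (T := T) (f := f) n (T x)
      rcases max_choice 0 (f x + maxBirkhoffSum T f n (T x)) with h | h <;> linarith
  · rw [Set.indicator_of_notMem (by exact hx)]
    linarith [maxBirkhoffSum_nonneg (T := T) (f := f) n (T x)]

/-- The points whose Birkhoff averages of `f` have lower limit at most `a` and upper limit at
least `b`. -/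
def oscillationSet (T : α → α) (f : α → ℝ) (a b : ℝ) : Set α :=
  {x | ∀ q : ℚ, 0 < q → (∃ᶠ n in atTop, birkhoffAverage ℝ T f n x < a + q) ∧
    ∃ᶠ n in atTop, b - q < birkhoffAverage ℝ T f n x}

theorem mem_oscillationSet_of_tendsto_sub {x y : α} {a b : ℝ}
    (h : Tendsto (fun n => birkhoffAverage ℝ T f n x - birkhoffAverage ℝ T f n y) atTop (nhds 0))
    (hx : x ∈ oscillationSet T f a b) : y ∈ oscillationSet T f a b := by
  intro q hq
  have hq' : (0 : ℝ) < ((q / 2 : ℚ) : ℝ) := by exact_mod_cast half_pos hq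
  have hq2 : ((q / 2 : ℚ) : ℝ) = q / 2 := by push_cast; rfl
  have hev := Metric.tendsto_nhds.1 h _ hq'
  obtain ⟨h1, h2⟩ := hx (q / 2) (half_pos hq)
  constructor
  · refine (h1.and_eventually hev).mono fun n ⟨hn, hd⟩ => ?_
    rw [Real.dist_eq, sub_zero, abs_lt] at hd
    linarith
  · refine (h2.and_eventually hev).mono fun n ⟨hn, hd⟩ => ?_
    rw [Real.dist_eq, sub_zero, abs_lt] at hd
    linarith

theorem preimage_oscillationSet (hb : Bornology.IsBounded (Set.range f)) (a b : ℝ) :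
    T ⁻¹' oscillationSet T f a b = oscillationSet T f a b := by
  ext x
  have h := tendsto_birkhoffAverage_apply_sub_birkhoffAverage' ℝ hb T x
  refine ⟨mem_oscillationSet_of_tendsto_sub h, mem_oscillationSet_of_tendsto_sub ?_⟩
  simpa using h.neg

theorem birkhoffSum_sub_const_pos {x : α} {c : ℝ} {n : ℕ} (hn : 0 < n)
    (h : c < birkhoffAverage ℝ T f n x) : 0 < birkhoffSum T (fun y => f y - c) n x := by
  have hn' : (0 : ℝ) < n := by exact_mod_cast hn
  rw [birkhoffAverage, smul_eq_mul, lt_inv_mul_iff₀ hn'] at h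
  simpa [birkhoffSum] using h

theorem birkhoffSum_const_sub_pos {x : α} {c : ℝ} {n : ℕ} (hn : 0 < n)
    (h : birkhoffAverage ℝ T f n x < c) : 0 < birkhoffSum T (fun y => c - f y) n x := by
  have hn' : (0 : ℝ) < n := by exact_mod_cast hn
  rw [birkhoffAverage, smul_eq_mul, inv_mul_lt_iff₀ hn'] at h
  simpa [birkhoffSum] using h

theorem abs_birkhoffAverage_le {C : ℝ} (hC : ∀ x, |f x| ≤ C) (n : ℕ) (x : α) :
    |birkhoffAverage ℝ T f n x| ≤ C := by
  rcases n.eq_zero_or_pos with rfl | hn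
  · simpa using (abs_nonneg _).trans (hC x)
  have hn' : (0 : ℝ) < n := by exact_mod_cast hn
  rw [birkhoffAverage, smul_eq_mul, abs_mul, abs_of_pos (inv_pos.2 hn'), inv_mul_le_iff₀ hn',
    birkhoffSum]
  refine (Finset.abs_sum_le_sum_abs _ _).trans ?_
  simpa using Finset.sum_le_card_nsmul (Finset.range n) _ C fun k _ => hC (T^[k] x)

variable [MeasurableSpace α] {μ : Measure α}

theorem measurable_maxBirkhoffSum (hT : Measurable T) (hf : Measurable f) (n : ℕ) :
    Measurable (maxBirkhoffSum T f n) := by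
  induction n with
  | zero => exact measurable_const
  | succ n ih => exact measurable_const.max (hf.add (ih.comp hT))

theorem integrable_maxBirkhoffSum (hT : MeasurePreserving T μ μ) (hf : Integrable f μ) (n : ℕ) :
    Integrable (maxBirkhoffSum T f n) μ := by
  induction n with
  | zero => exact integrable_zero _ _ _
  | succ n ih =>
    exact (integrable_zero _ _ _).sup (hf.add (hT.integrable_comp_of_integrable ih))

/-- A form of the maximal ergodic theorem. -/
theorem integral_nonneg_of_exists_birkhoffSum_pos (hT : MeasurePreserving T μ μ)
    (hfm : Measurable f) (hf : Integrable f μ)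
    (hpos : ∀ᵐ x ∂μ, ∃ n, 0 < birkhoffSum T f n x) : 0 ≤ ∫ x, f x ∂μ := by
  have hE (n : ℕ) : MeasurableSet {y | 0 < maxBirkhoffSum T f n y} :=
    measurableSet_lt measurable_const (measurable_maxBirkhoffSum hT.measurable hfm n)
  have hnonneg (n : ℕ) :
      0 ≤ ∫ x, {y | 0 < maxBirkhoffSum T f n y}.indicator f x ∂μ := by
    have hM := integrable_maxBirkhoffSum hT hf n
    have hMT : Integrable (fun x => maxBirkhoffSum T f n (T x)) μ :=
      hT.integrable_comp_of_integrable hM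
    have heq : ∫ x, maxBirkhoffSum T f n (T x) ∂μ = ∫ x, maxBirkhoffSum T f n x ∂μ := by
      conv_rhs => rw [← hT.map_eq]
      rw [integral_map hT.measurable.aemeasurable]
      exact (measurable_maxBirkhoffSum hT.measurable hfm n).aestronglyMeasurable
    calc (0 : ℝ) = ∫ x, (maxBirkhoffSum T f n x - maxBirkhoffSum T f n (T x)) ∂μ := by
          rw [integral_sub hM hMT, heq, sub_self]
      _ ≤ _ := integral_mono (hM.sub hMT) (hf.indicator (hE n))
          (maxBirkhoffSum_sub_le_indicator n)
  refine ge_of_tendsto' (tendsto_integral_of_dominated_convergence (fun x => ‖f x‖)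
    (fun n => (hf.indicator (hE n)).aestronglyMeasurable) hf.norm
    (fun n => Eventually.of_forall fun x => norm_indicator_le_norm_self f x) ?_) hnonneg
  filter_upwards [hpos] with x ⟨n, hn⟩
  refine tendsto_const_nhds.congr' ?_
  filter_upwards [eventually_ge_atTop n] with m hm
  have : 0 < maxBirkhoffSum T f m x :=
    hn.trans_le ((birkhoffSum_le_maxBirkhoffSum n x).trans (maxBirkhoffSum_mono x hm))
  rw [Set.indicator_of_mem (by exact this)]

theorem measurable_birkhoffAverage (hT : Measurable T) (hf : Measurable f) (n : ℕ) :
    Measurable (birkhoffAverage ℝ T f n) := by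
  have h : Measurable fun x => ∑ k ∈ Finset.range n, f (T^[k] x) :=
    Finset.measurable_sum _ fun k _ => hf.comp (hT.iterate k)
  exact h.const_smul (n : ℝ)⁻¹

theorem measurableSet_oscillationSet (hT : Measurable T) (hf : Measurable f) (a b : ℝ) :
    MeasurableSet (oscillationSet T f a b) := by
  have hA := measurable_birkhoffAverage hT hf
  simp only [oscillationSet, frequently_atTop, Set.ofPred_forall, Set.ofPred_and, Set.ofPred_exists]
  refine .iInter fun q => .iInter fun _ => .inter ?_ ?_
  · exact .iInter fun n => .iUnion fun m => .inter (.const _)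
      (measurableSet_lt (hA m) measurable_const)
  · exact .iInter fun n => .iUnion fun m => .inter (.const _)
      (measurableSet_lt measurable_const (hA m))

theorem measure_oscillationSet_eq_zero [IsFiniteMeasure μ] (hT : MeasurePreserving T μ μ)
    (hfm : Measurable f) (hb : Bornology.IsBounded (Set.range f)) {a b : ℝ} (hab : a < b) :
    μ (oscillationSet T f a b) = 0 := by
  set A := oscillationSet T f a b with hA
  have hAm : MeasurableSet A := measurableSet_oscillationSet hT.measurable hfm a b
  have hTA : MeasurePreserving T (μ.restrict A) (μ.restrict A) := by
    simpa only [hA, preimage_oscillationSet hb] using hT.restrict_preimage hAm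
  have hf : Integrable f (μ.restrict A) := by
    obtain ⟨C, hC⟩ := isBounded_iff_forall_norm_le.1 hb
    exact .of_bound hfm.aestronglyMeasurable C
      (Eventually.of_forall fun x => hC _ (Set.mem_range_self x))
  obtain ⟨q, hq0, hq⟩ := exists_rat_btwn (show (0 : ℝ) < (b - a) / 2 by linarith)
  have hq0' : 0 < q := by exact_mod_cast hq0
  have h1 := integral_nonneg_of_exists_birkhoffSum_pos hTA (hfm.sub_const (b - q))
    (hf.sub (integrable_const _)) <| by
      filter_upwards [ae_restrict_mem hAm] with x hx
      obtain ⟨n, hn, h⟩ := frequently_atTop.1 (hx q hq0').2 1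
      exact ⟨n, birkhoffSum_sub_const_pos hn h⟩
  have h2 := integral_nonneg_of_exists_birkhoffSum_pos hTA (hfm.const_sub (a + q))
    ((integrable_const _).sub hf) <| by
      filter_upwards [ae_restrict_mem hAm] with x hx
      obtain ⟨n, hn, h⟩ := frequently_atTop.1 (hx q hq0').1 1
      exact ⟨n, birkhoffSum_const_sub_pos hn h⟩
  rw [integral_sub hf (integrable_const _), integral_const, smul_eq_mul] at h1
  rw [integral_sub (integrable_const _) hf, integral_const, smul_eq_mul] at h2
  rw [measureReal_restrict_apply_univ] at h1 h2
  have h3 : 0 ≤ μ.real A := measureReal_nonneg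
  rw [← measureReal_eq_zero_iff]
  nlinarith

/-- The Birkhoff pointwise ergodic theorem for bounded measurable functions. -/
theorem ae_exists_tendsto_birkhoffAverage [IsFiniteMeasure μ] (hT : MeasurePreserving T μ μ)
    (hfm : Measurable f) (hb : Bornology.IsBounded (Set.range f)) :
    ∀ᵐ x ∂μ, ∃ L : ℝ, Tendsto (fun n => birkhoffAverage ℝ T f n x) atTop (nhds L) := by
  have hae : ∀ᵐ x ∂μ, ∀ p : ℚ × ℚ, p.1 < p.2 → x ∉ oscillationSet T f p.1 p.2 := by
    refine ae_all_iff.2 fun p => ?_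
    by_cases hp : p.1 < p.2
    · simpa [hp] using measure_eq_zero_iff_ae_notMem.1
        (measure_oscillationSet_eq_zero hT hfm hb (Rat.cast_lt.2 hp))
    · simp [hp]
  obtain ⟨C, hC⟩ := isBounded_iff_forall_norm_le.1 hb
  have hC' : ∀ x, |f x| ≤ C := fun x => hC _ (Set.mem_range_self x)
  filter_upwards [hae] with x hx
  refine tendsto_of_no_upcrossings Rat.denseRange_cast ?_
    (isBoundedUnder_of ⟨C, fun n => (abs_le.1 (abs_birkhoffAverage_le hC' n x)).2⟩)
    (isBoundedUnder_of ⟨-C, fun n => (abs_le.1 (abs_birkhoffAverage_le hC' n x)).1⟩)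
  rintro _ ⟨p, rfl⟩ _ ⟨r, rfl⟩ hpr ⟨h1, h2⟩
  refine hx (p, r) (Rat.cast_lt.1 hpr) fun q hq => ?_
  have hq' : (0 : ℝ) < q := by exact_mod_cast hq
  exact ⟨h1.mono fun n hn => by simp only; linarith, h2.mono fun n hn => by simp only; linarith⟩

end Maximal

section InvariantMeasure

variable {X : Type*} [MeasurableSpace X]

/-- The empirical measure of the first `n + 1` points of the orbit of `x` under `T`. -/
noncomputable def orbitEmpiricalMeasure (T : X → X) (x : X) (n : ℕ) : ProbabilityMeasure X :=
  ⟨((n + 1 : ℕ) : ENNReal)⁻¹ • ∑ k ∈ Finset.range (n + 1), Measure.dirac (T^[k] x), ⟨by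
    simp only [Measure.smul_apply, Measure.finsetSum_apply, measure_univ, Finset.sum_const,
      Finset.card_range, nsmul_eq_mul, mul_one, smul_eq_mul]
    exact ENNReal.inv_mul_cancel (by simp) (ENNReal.natCast_ne_top _)⟩⟩

variable [TopologicalSpace X] [BorelSpace X]

theorem integral_orbitEmpiricalMeasure (T : X → X) (x : X) (n : ℕ)
    (φ : BoundedContinuousFunction X ℝ) :
    ∫ y, φ y ∂(orbitEmpiricalMeasure T x n : Measure X) = birkhoffAverage ℝ T φ (n + 1) x := by
  have hφ : StronglyMeasurable φ := φ.continuous.measurable.stronglyMeasurable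
  simp only [orbitEmpiricalMeasure, ProbabilityMeasure.coe_mk]
  rw [integral_smul_measure, integral_finsetSum_measure]
  · simp only [integral_dirac' _ _ hφ, birkhoffAverage, birkhoffSum, ENNReal.toReal_inv,
      ENNReal.toReal_natCast]
  · exact fun k _ => φ.integrable _

/-- The Krylov–Bogoliubov theorem. -/
theorem exists_measurePreserving_of_continuous [CompactSpace X] [T2Space X]
    [HasOuterApproxClosed X] [Nonempty X] {T : X → X} (hT : Continuous T) :
    ∃ μ : Measure X, IsProbabilityMeasure μ ∧ MeasurePreserving T μ μ := by
  obtain ⟨x⟩ := ‹Nonempty X›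
  let F : Ultrafilter ℕ := hyperfilter ℕ
  have hF : (F : Filter ℕ) ≤ atTop := by
    rw [← Nat.cofinite_eq_atTop]; exact hyperfilter_le_cofinite
  obtain ⟨μ, -, hμ⟩ := isCompact_univ.ultrafilter_le_nhds
    (F.map (orbitEmpiricalMeasure T x)) (by simp)
  have hμ' : Tendsto (orbitEmpiricalMeasure T x) F (nhds μ) := hμ
  rw [ProbabilityMeasure.tendsto_iff_forall_integral_tendsto] at hμ'
  simp only [integral_orbitEmpiricalMeasure] at hμ'
  refine ⟨μ, inferInstance, hT.measurable, ?_⟩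
  have : IsProbabilityMeasure ((μ : Measure X).map T) :=
    Measure.isProbabilityMeasure_map hT.measurable.aemeasurable
  refine ext_of_forall_integral_eq_of_IsFiniteMeasure fun φ => ?_
  rw [integral_map hT.measurable.aemeasurable φ.continuous.measurable.aestronglyMeasurable]
  have h1 := hμ' (φ.compContinuous ⟨T, hT⟩)
  have h2 := hμ' φ
  have h3 := ((tendsto_birkhoffAverage_apply_sub_birkhoffAverage' ℝ φ.isBounded_range T x).comp
    (tendsto_add_atTop_nat 1)).mono_left hF
  have h4 : ∀ n, birkhoffAverage ℝ T (φ.compContinuous ⟨T, hT⟩) n x =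
      birkhoffAverage ℝ T φ n (T x) := by
    intro n
    simp only [birkhoffAverage, birkhoffSum, BoundedContinuousFunction.compContinuous_apply,
      ContinuousMap.coe_mk, ← Function.iterate_succ_apply, ← Function.iterate_succ_apply']
  simp only [h4] at h1
  have h5 := tendsto_nhds_unique (h1.sub h2) h3
  simpa [sub_eq_zero] using h5

end InvariantMeasure

section Quotient

/-- The differences `z_{j+1} - z_1` of the coordinates of `z`. -/
def coordDiff (d : ℕ) (z : Fin d → ℝ) : Fin (d - 1) → ℝ :=
  fun j => z ⟨(j : ℕ) + 1, by have hj := j.isLt; omega⟩ - z ⟨0, by have hj := j.isLt; omega⟩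

theorem eq_hatv_coordDiff_add {d : ℕ} (hd : 0 < d) (z : Fin d → ℝ) :
    z = fun i => hatv d (coordDiff d z) i + z ⟨0, hd⟩ := by
  funext ⟨i, hi⟩
  cases i <;> simp [hatv, coordDiff]

theorem continuous_hatv (d : ℕ) : Continuous (hatv d) := by
  refine continuous_pi fun i => ?_
  unfold hatv
  split_ifs
  · exact continuous_const
  · exact continuous_apply _

variable {d : ℕ} {f : (Fin d → ℝ) → Fin d → ℝ}

theorem continuous_quotG (hf : Continuous f) : Continuous (quotG d f) := by
  have h := hf.comp (continuous_hatv d)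
  exact continuous_pi fun j => ((continuous_apply _).comp h).sub ((continuous_apply _).comp h)

theorem continuous_quotH (hf : Continuous f) : Continuous (quotH d f) := by
  have h := hf.comp (continuous_hatv d)
  unfold quotH
  split_ifs
  · exact (continuous_apply _).comp h
  · exact continuous_const

theorem coordDiff_apply_eq_quotG
    (hhom : ∀ (x : Fin d → ℝ) (c : ℝ), f (fun i => x i + c) = fun i => f x i + c)
    (hd : 0 < d) (z : Fin d → ℝ) :
    coordDiff d (f z) = quotG d f (coordDiff d z) := by
  conv_lhs => rw [eq_hatv_coordDiff_add hd z, hhom]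
  funext j
  simp [coordDiff, quotG]

theorem iterate_hatv
    (hhom : ∀ (x : Fin d → ℝ) (c : ℝ), f (fun i => x i + c) = fun i => f x i + c)
    (hd : 0 < d) (y : Fin (d - 1) → ℝ) (n : ℕ) :
    f^[n] (hatv d y) =
      fun i => hatv d ((quotG d f)^[n] y) i + birkhoffSum (quotG d f) (quotH d f) n y := by
  induction n with
  | zero => simp
  | succ n ih =>
    rw [Function.iterate_succ_apply', ih, hhom, Function.iterate_succ_apply', birkhoffSum_succ]
    funext i
    have h := congrFun (eq_hatv_coordDiff_add hd (f (hatv d ((quotG d f)^[n] y)))) i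
    have hG : coordDiff d (f (hatv d ((quotG d f)^[n] y))) =
      quotG d f ((quotG d f)^[n] y) := rfl
    rw [hG] at h
    rw [h, quotH, dif_pos hd]
    ring

end Quotient

/-- for a continuous additively 1-homogeneous map whose trajectory
from some `x⁰` has bounded coordinate differences, there is a Borel probability
measure `Q` invariant under the quotient map `g` such that for `Q`-a.e. `y` the
growth rate exists (Birkhoff average of `h` along `g`, equivalently
`lim_N x^N_1/N` for the trajectory started at `ŷ`). -/
theorem homogeneous_growth_rate (d : ℕ) (hd : 2 ≤ d)
    (f : (Fin d → ℝ) → Fin d → ℝ) (hf : Continuous f)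
    (hhom : ∀ (x : Fin d → ℝ) (c : ℝ), f (fun i => x i + c) = fun i => f x i + c)
    (x : ℕ → Fin d → ℝ) (hx : ∀ k, x (k + 1) = f (x k))
    (hbdd : ∃ C : ℝ, ∀ (k : ℕ) (j : Fin d), |x k j - x k ⟨0, by omega⟩| ≤ C) :
    ∃ Q : Measure (Fin (d - 1) → ℝ), IsProbabilityMeasure Q ∧
      MeasurePreserving (quotG d f) Q Q ∧
      ∀ᵐ y ∂Q, ∃ L : ℝ,
        Tendsto (fun N : ℕ =>
            (∑ k ∈ Finset.range N, quotH d f ((quotG d f)^[k] y)) / N) atTop (nhds L) ∧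
        Tendsto (fun N : ℕ => (f^[N] (hatv d y)) ⟨0, by omega⟩ / N) atTop (nhds L) := by
  have hd0 : 0 < d := by omega
  obtain ⟨C, hC⟩ := hbdd
  set g := quotG d f with hg
  have hgc : Continuous g := continuous_quotG hf
  have hhc : Continuous (quotH d f) := continuous_quotH hf
  let S : Set (Fin (d - 1) → ℝ) := Set.range fun k => coordDiff d (x k)
  have hS : Bornology.IsBounded S := by
    refine isBounded_iff_forall_norm_le.2 ⟨C, ?_⟩
    rintro _ ⟨k, rfl⟩
    exact (pi_norm_le_iff_of_nonneg ((abs_nonneg _).trans (hC 0 ⟨0, hd0⟩))).2 fun j => hC k _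
  have hgS : Set.MapsTo g S S := by
    rintro _ ⟨k, rfl⟩
    exact ⟨k + 1, by simp only [hx, hg, coordDiff_apply_eq_quotG hhom hd0]⟩
  have hgK : Set.MapsTo g (closure S) (closure S) := hgS.closure hgc
  have : CompactSpace (closure S) := isCompact_iff_compactSpace.1 hS.isCompact_closure
  have : Nonempty (closure S) := ⟨⟨_, subset_closure ⟨0, rfl⟩⟩⟩
  let T : closure S → closure S := hgK.restrict
  have hT : Continuous T := hgc.restrict hgK
  obtain ⟨μ, hμ, hTμ⟩ := exists_measurePreserving_of_continuous hT
  have hval : Measurable (Subtype.val : closure S → Fin (d - 1) → ℝ) := measurable_subtype_coe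
  let φ : closure S → ℝ := fun y => quotH d f y
  have hφ : Continuous φ := hhc.comp continuous_subtype_val
  have hsemi : Function.Semiconj (Subtype.val : closure S → Fin (d - 1) → ℝ) T g := fun _ => rfl
  refine ⟨μ.map Subtype.val, Measure.isProbabilityMeasure_map hval.aemeasurable,
    ⟨hgc.measurable, ?_⟩, ?_⟩
  · rw [Measure.map_map hgc.measurable hval, ← hsemi.comp_eq,
      ← Measure.map_map hval hTμ.measurable, hTμ.map_eq]
  · rw [(MeasurableEmbedding.subtype_coe isClosed_closure.measurableSet).ae_map_iff]
    filter_upwards [ae_exists_tendsto_birkhoffAverage hTμ hφ.measurable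
      (isCompact_range hφ).isBounded] with y ⟨L, hL⟩
    have hsum : ∀ n, birkhoffSum g (quotH d f) n y / n = birkhoffAverage ℝ T φ n y := by
      intro n
      simp only [birkhoffAverage, birkhoffSum, smul_eq_mul, div_eq_inv_mul, φ,
        (hsemi.iterate_right _).eq]
    have hlim : Tendsto (fun n : ℕ => birkhoffSum g (quotH d f) n y / n) atTop (nhds L) := by
      simpa only [hsum] using hL
    refine ⟨L, hlim, ?_⟩
    simpa [iterate_hatv hhom hd0, hatv] using hlim
end

section
/- For the junction dynamics f on ℝ^{n+m}, the trajectory (q^k)_{k∈ℕ} defined by q^0 = 0 and q^{k+1} = f(q^k) satisfies: q^k_i ≥ 0 for all i and k, and q^{k+1}_i ≥ q^k_i for all i and k; that is, the state trajectories starting from 0 are nonnegative and nondecreasing in every coordinate. -/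
/-- The junction dynamics on two circular roads of `n` and `m` sections crossing
at one junction.  Coordinates `1, …, n` form the priority road, `n+1, …, n+m`
the non-priority road; `ā_i = 1 - a_i` for `i ∉ {n, n+m}` and
`ā_n = ā_{n+m} = 1 - a_n - a_{n+m}`. -/
noncomputable def junctionF (n m : ℕ) (a : ℕ → ℝ) (q : ℕ → ℝ) : ℕ → ℝ :=
  fun i =>
    if i = 1 then
      min (a n + (q n + q (n + m)) / 2) ((1 - a 1) + q 2)
    else if i = n then
      min ((1 - a n - a (n + m)) + q 1 + q (n + 1) - q (n + m)) (a (n - 1) + q (n - 1))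
    else if i = n + 1 then
      min (a (n + m) + (q n + q (n + m)) / 2) ((1 - a (n + 1)) + q (n + 2))
    else if i = n + m then
      min ((1 - a n - a (n + m)) + q 1 + q (n + 1)
            - min ((1 - a n - a (n + m)) + q 1 + q (n + 1) - q (n + m))
                (a (n - 1) + q (n - 1)))
          (a (n + m - 1) + q (n + m - 1))
    else
      min (a (i - 1) + q (i - 1)) ((1 - a i) + q (i + 1))

theorem junctionF_zero_nonneg (n m : ℕ) (hn : 3 ≤ n) (hm : 3 ≤ m)
    (a : ℕ → ℝ) (ha : ∀ i, 1 ≤ i → i ≤ n + m → 0 ≤ a i ∧ a i ≤ 1)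
    (hjunc : a n + a (n + m) ≤ 1) (q : ℕ → ℝ) (hq : ∀ i, q i = 0)
    (i : ℕ) (h1 : 1 ≤ i) (hi : i ≤ n + m) : 0 ≤ junctionF n m a q i := by
  have hc : 0 ≤ 1 - a n - a (n + m) := by linarith
  have han := ha n (by omega) (by omega)
  have hanm := ha (n + m) (by omega) (by omega)
  have hai := ha i h1 hi
  unfold junctionF
  simp only [hq, add_zero, sub_zero, zero_div]
  split_ifs with h_one h_n h_n1 h_nm
  · subst h_one
    exact le_min han.1 (by linarith)
  · exact le_min hc (ha (n - 1) (by omega) (by omega)).1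
  · subst h_n1
    exact le_min hanm.1 (by linarith)
  · exact le_min (sub_nonneg.2 (min_le_left _ _)) (ha (n + m - 1) (by omega) (by omega)).1
  · exact le_min (ha (i - 1) (by omega) (by omega)).1 (by linarith)

/-- Although `junctionF` is not monotone, it maps sub-fixed points to sub-fixed points. -/
theorem le_junctionF_junctionF (n m : ℕ) (hn : 3 ≤ n) (hm : 3 ≤ m) (a q : ℕ → ℝ)
    (hq : ∀ i, 1 ≤ i → i ≤ n + m → q i ≤ junctionF n m a q i)
    (i : ℕ) (h1 : 1 ≤ i) (hi : i ≤ n + m) :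
    junctionF n m a q i ≤ junctionF n m a (junctionF n m a q) i := by
  obtain ⟨p, hp⟩ : ∃ p, p = junctionF n m a q := ⟨_, rfl⟩
  rw [← hp] at hq ⊢
  have hpn : p n = min ((1 - a n - a (n + m)) + q 1 + q (n + 1) - q (n + m))
      (a (n - 1) + q (n - 1)) := by
    rw [hp, junctionF, if_neg (by omega), if_pos rfl]
  have hpnm : p (n + m) = min ((1 - a n - a (n + m)) + q 1 + q (n + 1) - p n)
      (a (n + m - 1) + q (n + m - 1)) := by
    rw [hpn, hp, junctionF, if_neg (by omega), if_neg (by omega), if_neg (by omega), if_pos rfl]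
  have hq_one := hq 1 le_rfl (by omega)
  have hq_n := hq n (by omega) (by omega)
  have hq_n1 := hq (n + 1) (by omega) (by omega)
  have hq_nm := hq (n + m) (by omega) (by omega)
  have hA : p n ≤ a (n - 1) + p (n - 1) :=
    hpn.trans_le (min_le_right _ _) |>.trans (by linarith [hq (n - 1) (by omega) (by omega)])
  have hB : p (n + m) ≤ a (n + m - 1) + p (n + m - 1) :=
    hpnm.trans_le (min_le_right _ _) |>.trans
      (by linarith [hq (n + m - 1) (by omega) (by omega)])
  have hS : p (n + m) ≤ (1 - a n - a (n + m)) + q 1 + q (n + 1) - p n :=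
    hpnm.trans_le (min_le_left _ _)
  unfold junctionF
  split_ifs with h_one h_n h_n1 h_nm
  · subst h_one
    rw [hp, junctionF, if_pos rfl, ← hp]
    exact min_le_min (by linarith) (by linarith [hq 2 (by omega) (by omega)])
  · subst h_n
    exact le_min (by linarith) hA
  · subst h_n1
    rw [hp, junctionF, if_neg h_one, if_neg h_n, if_pos rfl, ← hp]
    exact min_le_min (by linarith) (by linarith [hq (n + 2) (by omega) (by omega)])
  · subst h_nm
    refine le_min ?_ hB
    rw [le_sub_comm]
    exact min_le_left _ _
  · rw [hp, junctionF, if_neg h_one, if_neg h_n, if_neg h_n1, if_neg h_nm, ← hp]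
    exact min_le_min (by linarith [hq (i - 1) (by omega) (by omega)])
      (by linarith [hq (i + 1) (by omega) (by omega)])

/-- the junction trajectory starting from `0` is nonnegative and
nondecreasing in every coordinate. -/
theorem junction_traj_nonneg_monotone (n m : ℕ) (hn : 3 ≤ n) (hm : 3 ≤ m)
    (a : ℕ → ℝ) (ha : ∀ i, 1 ≤ i → i ≤ n + m → 0 ≤ a i ∧ a i ≤ 1)
    (hjunc : a n + a (n + m) ≤ 1)
    (q : ℕ → ℕ → ℝ) (hq0 : ∀ i, q 0 i = 0)
    (hq : ∀ k, q (k + 1) = junctionF n m a (q k)) :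
    ∀ (k : ℕ) (i : ℕ), 1 ≤ i → i ≤ n + m → 0 ≤ q k i ∧ q k i ≤ q (k + 1) i := by
  have hmono : ∀ k i, 1 ≤ i → i ≤ n + m → q k i ≤ q (k + 1) i := by
    intro k
    induction k with
    | zero =>
      intro i h1 hi
      rw [hq, hq0]
      exact junctionF_zero_nonneg n m hn hm a ha hjunc _ hq0 i h1 hi
    | succ k ih =>
      intro i h1 hi
      rw [hq k] at ih
      rw [hq (k + 1), hq k]
      exact le_junctionF_junctionF n m hn hm a (q k) ih i h1 hi
  intro k i h1 hi
  refine ⟨?_, hmono k i h1 hi⟩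
  rw [← hq0 i]
  exact monotone_nat_of_le_succ (f := fun k => q k i) (fun k => hmono k i h1 hi) k.zero_le
end

section
/- For the junction dynamics f on ℝ^{n+m}, the trajectory (q^k)_{k∈ℕ} defined by q^0 = 0 and q^{k+1} = f(q^k) has uniformly bounded coordinate differences: there exists a constant c₁ such that sup_k |q^k_i − q^k_j| ≤ c₁ for all coordinates i, j. -/
/-- The admissible configurations: each section holds between `0` and `1` vehicle, and the junction
holds nonnegative amounts for both exits, with total at most `1`. -/
structure JunctionAdmissible (n m : ℕ) (a q : ℕ → ℝ) : Prop where
  section_nonneg : ∀ i, 1 ≤ i → i < n + m → i ≠ n → 0 ≤ a i + q i - q (i + 1)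
  section_le_one : ∀ i, 1 ≤ i → i < n + m → i ≠ n → a i + q i - q (i + 1) ≤ 1
  exit_nonneg : 0 ≤ a n + (q n + q (n + m)) / 2 - q 1
  exit_nonneg' : 0 ≤ a (n + m) + (q n + q (n + m)) / 2 - q (n + 1)
  junction_le_one : a n + a (n + m) + (q n + q (n + m)) - q 1 - q (n + 1) ≤ 1

theorem junctionF_le_upstream {n m : ℕ} (a q : ℕ → ℝ) {i : ℕ}
    (h1 : 1 ≤ i) (h3 : i ≠ n) :
    junctionF n m a q (i + 1) ≤ a i + q i := by
  have e1 : i + 1 ≠ 1 := by lia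
  have e2 : i + 1 ≠ n + 1 := by lia
  rw [junctionF, if_neg e1, if_neg e2]
  split_ifs with h h'
  · have : n - 1 = i := by lia
    rw [this]; exact min_le_right _ _
  · have : n + m - 1 = i := by lia
    rw [this]; exact min_le_right _ _
  · exact min_le_left _ _

theorem junctionF_le_downstream {n m : ℕ} (a q : ℕ → ℝ) {i : ℕ}
    (h2 : i < n + m) (h3 : i ≠ n) :
    junctionF n m a q i ≤ 1 - a i + q (i + 1) := by
  rw [junctionF, if_neg h3, if_neg h2.ne]
  split_ifs with h h'
  · subst h; exact min_le_right _ _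
  · subst h'; exact min_le_right _ _
  · exact min_le_right _ _

theorem junctionF_one_le {n m : ℕ} (a q : ℕ → ℝ) :
    junctionF n m a q 1 ≤ a n + (q n + q (n + m)) / 2 := by
  rw [junctionF, if_pos rfl]
  exact min_le_left _ _

theorem junctionF_succ_le {n m : ℕ} (hn : 3 ≤ n) (a q : ℕ → ℝ) :
    junctionF n m a q (n + 1) ≤ a (n + m) + (q n + q (n + m)) / 2 := by
  rw [junctionF, if_neg (by lia), if_neg (by lia), if_pos rfl]
  exact min_le_left _ _

theorem junctionF_apply_n {n m : ℕ} (hn : 3 ≤ n) (a q : ℕ → ℝ) :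
    junctionF n m a q n = min ((1 - a n - a (n + m)) + q 1 + q (n + 1) - q (n + m))
      (a (n - 1) + q (n - 1)) := by
  rw [junctionF, if_neg (by lia), if_pos rfl]

theorem junctionF_apply_add {n m : ℕ} (hn : 3 ≤ n) (hm : 3 ≤ m) (a q : ℕ → ℝ) :
    junctionF n m a q (n + m) = min ((1 - a n - a (n + m)) + q 1 + q (n + 1)
      - junctionF n m a q n) (a (n + m - 1) + q (n + m - 1)) := by
  rw [junctionF_apply_n hn, junctionF, if_neg (by lia), if_neg (by lia), if_neg (by lia), if_pos rfl]

namespace JunctionAdmissible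

variable {n m : ℕ} {a q : ℕ → ℝ}

theorem le_junctionF (h : JunctionAdmissible n m a q) (hn : 3 ≤ n) (hm : 3 ≤ m) {i : ℕ}
    (h1 : 1 ≤ i) (h2 : i ≤ n + m) : q i ≤ junctionF n m a q i := by
  have hJ := h.junction_le_one
  have up : ∀ j, 1 ≤ j - 1 → j ≤ n + m → j ≠ n + 1 → q j ≤ a (j - 1) + q (j - 1) := by
    intro j hj hj' hj''
    have := h.section_nonneg (j - 1) hj (by lia) (by lia)
    rw [Nat.sub_add_cancel (by lia)] at this
    linarith
  have down : ∀ j, 1 ≤ j → j < n + m → j ≠ n → q j ≤ 1 - a j + q (j + 1) := by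
    intro j hj hj' hj''
    linarith [h.section_le_one j hj hj' hj'']
  rcases eq_or_ne i (n + m) with rfl | hi
  · rw [junctionF_apply_add hn hm, junctionF_apply_n hn]
    refine le_min ?_ (up _ (by lia) le_rfl (by lia))
    linarith [min_le_left ((1 - a n - a (n + m)) + q 1 + q (n + 1) - q (n + m))
      (a (n - 1) + q (n - 1))]
  rw [junctionF, if_neg hi]
  split_ifs with c1 c2 c3
  · subst c1
    exact le_min (by linarith [h.exit_nonneg]) (down 1 le_rfl (by lia) (by lia))
  · subst c2
    exact le_min (by linarith) (up _ (by lia) (by lia) (by lia))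
  · subst c3
    exact le_min (by linarith [h.exit_nonneg']) (down _ (by lia) (by lia) (by lia))
  · exact le_min (up _ (by lia) (by lia) c3) (down _ h1 (by lia) c2)

theorem map_junctionF (h : JunctionAdmissible n m a q) (hn : 3 ≤ n) (hm : 3 ≤ m) :
    JunctionAdmissible n m a (junctionF n m a q) where
  section_nonneg i h1 h2 h3 := by
    linarith [junctionF_le_upstream (m := m) a q h1 h3, h.le_junctionF hn hm h1 h2.le]
  section_le_one i h1 h2 h3 := by
    linarith [junctionF_le_downstream a q h2 h3,
      h.le_junctionF hn hm (i := i + 1) (by lia) (by lia)]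
  exit_nonneg := by
    linarith [junctionF_one_le (n := n) (m := m) a q,
      h.le_junctionF hn hm (i := n) (by lia) (by lia),
      h.le_junctionF hn hm (i := n + m) (by lia) (by lia)]
  exit_nonneg' := by
    linarith [junctionF_succ_le (m := m) hn a q,
      h.le_junctionF hn hm (i := n) (by lia) (by lia),
      h.le_junctionF hn hm (i := n + m) (by lia) (by lia)]
  junction_le_one := by
    have := junctionF_apply_add hn hm a q ▸ min_le_left ((1 - a n - a (n + m)) + q 1 + q (n + 1)
      - junctionF n m a q n) (a (n + m - 1) + q (n + m - 1))
    linarith [h.le_junctionF hn hm (i := 1) (by lia) (by lia),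
      h.le_junctionF hn hm (i := n + 1) (by lia) (by lia)]

theorem abs_sub_succ_le_one (h : JunctionAdmissible n m a q)
    (ha : ∀ i, 1 ≤ i → i ≤ n + m → 0 ≤ a i ∧ a i ≤ 1) {i : ℕ}
    (h1 : 1 ≤ i) (h2 : i < n + m) (h3 : i ≠ n) : |q (i + 1) - q i| ≤ 1 := by
  obtain ⟨ha0, ha1⟩ := ha i h1 h2.le
  rw [abs_le]
  constructor <;> linarith [h.section_nonneg i h1 h2 h3, h.section_le_one i h1 h2 h3]

theorem abs_exit_sub_le (h : JunctionAdmissible n m a q)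
    (ha : ∀ i, 1 ≤ i → i ≤ n + m → 0 ≤ a i ∧ a i ≤ 1) (hn : 3 ≤ n) :
    |q (n + 1) - q 1| ≤ 2 := by
  obtain ⟨h0, h1⟩ := ha n (by lia) (by lia)
  obtain ⟨h2, h3⟩ := ha (n + m) (by lia) le_rfl
  rw [abs_le]
  constructor <;> linarith [h.exit_nonneg, h.exit_nonneg', h.junction_le_one]

theorem abs_sub_one_le (h : JunctionAdmissible n m a q)
    (ha : ∀ i, 1 ≤ i → i ≤ n + m → 0 ≤ a i ∧ a i ≤ 1) (hn : 3 ≤ n) {i : ℕ}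
    (h1 : 1 ≤ i) (h2 : i ≤ n + m) : |q i - q 1| ≤ i + 2 := by
  induction i, h1 using Nat.le_induction with
  | base => simp; norm_num
  | succ i h1 ih =>
    push_cast
    by_cases hi : i = n
    · subst hi
      linarith [h.abs_exit_sub_le ha hn, (Nat.cast_nonneg i : (0 : ℝ) ≤ i)]
    · linarith [ih (by lia), h.abs_sub_succ_le_one ha h1 h2 hi, abs_sub_le (q (i + 1)) (q i) (q 1)]

end JunctionAdmissible

/-- the junction trajectory starting from `0` has uniformly
bounded coordinate differences. -/
theorem junction_traj_bounded_differences (n m : ℕ) (hn : 3 ≤ n) (hm : 3 ≤ m)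
    (a : ℕ → ℝ) (ha : ∀ i, 1 ≤ i → i ≤ n + m → 0 ≤ a i ∧ a i ≤ 1)
    (hjunc : a n + a (n + m) ≤ 1)
    (q : ℕ → ℕ → ℝ) (hq0 : ∀ i, q 0 i = 0)
    (hq : ∀ k, q (k + 1) = junctionF n m a (q k)) :
    ∃ c₁ : ℝ, ∀ (k : ℕ) (i j : ℕ), 1 ≤ i → i ≤ n + m → 1 ≤ j → j ≤ n + m →
      |q k i - q k j| ≤ c₁ := by
  have adm : ∀ k, JunctionAdmissible n m a (q k) := by
    intro k
    induction k with
    | zero =>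
      have hA := (ha n (by lia) (by lia)).1
      have hB := (ha (n + m) (by lia) le_rfl).1
      constructor
      · intro i h1 h2 _
        simpa [hq0] using (ha i h1 h2.le).1
      · intro i h1 h2 _
        simpa [hq0] using (ha i h1 h2.le).2
      all_goals simpa [hq0]
    | succ k ih => exact hq k ▸ ih.map_junctionF hn hm
  have bound : ∀ k i, 1 ≤ i → i ≤ n + m → |q k i - q k 1| ≤ (n + m : ℕ) + 2 := by
    intro k i h1 h2
    have : (i : ℝ) ≤ (n + m : ℕ) := by exact_mod_cast h2
    linarith [(adm k).abs_sub_one_le ha hn h1 h2]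
  refine ⟨2 * ((n + m : ℕ) + 2), fun k i j hi hi' hj hj' => ?_⟩
  have := abs_sub_le (q k i) (q k 1) (q k j)
  rw [abs_sub_comm (q k 1)] at this
  linarith [bound k i hi hi', bound k j hj hj']
end

section
/- For the junction dynamics f on ℝ^{n+m}, consider the trajectory q^0 = 0, q^{k+1} = f(q^k). If an average growth rate exists, i.e. there is χ ∈ ℝ such that for every coordinate i the sequence q^k_i / k converges to χ as k → ∞, then χ ≤ 1/4. -/
open Filter

/-- One step of the junction: the outgoing total `f(q)_n + f(q)_{n+m}` is bounded by the free
room plus `q_1 + q_{n+1}`. -/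
theorem junctionF_exit_add_le (n m : ℕ) (hn : 3 ≤ n) (hm : 3 ≤ m) (a q : ℕ → ℝ) :
    junctionF n m a q n + junctionF n m a q (n + m) ≤
      1 - a n - a (n + m) + (q 1 + q (n + 1)) := by
  have h1 : n ≠ 1 := by omega
  have h2 : n + m ≠ 1 := by omega
  have h3 : n + m ≠ n := by omega
  have h4 : n + m ≠ n + 1 := by omega
  simp only [junctionF, if_neg h1, if_neg h2, if_neg h3, if_neg h4, if_true]
  linarith [min_le_left (1 - a n - a (n + m) + q 1 + q (n + 1)
    - min (1 - a n - a (n + m) + q 1 + q (n + 1) - q (n + m)) (a (n - 1) + q (n - 1)))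
    (a (n + m - 1) + q (n + m - 1))]

/-- One step of the junction: the incoming total `f(q)_1 + f(q)_{n+1}` is bounded by the number
of cars in the junction plus `q_n + q_{n+m}`. -/
theorem junctionF_entry_add_le (n m : ℕ) (hn : 3 ≤ n) (a q : ℕ → ℝ) :
    junctionF n m a q 1 + junctionF n m a q (n + 1) ≤
      a n + a (n + m) + (q n + q (n + m)) := by
  have h1 : n + 1 ≠ 1 := by omega
  have h2 : n + 1 ≠ n := by omega
  simp only [junctionF, if_neg h1, if_neg h2, if_true]
  linarith [min_le_left (a n + (q n + q (n + m)) / 2) (1 - a 1 + q 2),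
    min_le_left (a (n + m) + (q n + q (n + m)) / 2) (1 - a (n + 1) + q (n + 2))]

/-- if the average growth rate of the junction trajectory from
`0` exists, it is at most `1/4`. -/
theorem junction_growth_rate_le_quarter (n m : ℕ) (hn : 3 ≤ n) (hm : 3 ≤ m)
    (a : ℕ → ℝ) (ha : ∀ i, 1 ≤ i → i ≤ n + m → 0 ≤ a i ∧ a i ≤ 1)
    (hjunc : a n + a (n + m) ≤ 1)
    (q : ℕ → ℕ → ℝ) (hq0 : ∀ i, q 0 i = 0)
    (hq : ∀ k, q (k + 1) = junctionF n m a (q k))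
    (χ : ℝ)
    (hχ : ∀ i, 1 ≤ i → i ≤ n + m →
      Tendsto (fun k : ℕ => q k i / k) atTop (nhds χ)) :
    χ ≤ 1 / 4 := by
  have hstep : ∀ k, q (k + 2) n + q (k + 2) (n + m) ≤ 1 + (q k n + q k (n + m)) := by
    intro k
    have hexit := junctionF_exit_add_le n m hn hm a (q (k + 1))
    have hentry := junctionF_entry_add_le n m hn a (q k)
    rw [← hq] at hexit hentry
    linarith
  have hbound : ∀ k : ℕ, q (2 * k) n + q (2 * k) (n + m) ≤ k := by
    intro k
    induction k with
    | zero => simp [hq0]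
    | succ k ih =>
      have := hstep (2 * k)
      rw [mul_add, mul_one]
      push_cast
      linarith
  have hlim : Tendsto (fun k : ℕ => q k n / k + q k (n + m) / k) atTop (nhds (χ + χ)) :=
    (hχ n (by omega) (by omega)).add (hχ (n + m) (by omega) le_rfl)
  have hdouble : Tendsto (fun k : ℕ => 2 * k) atTop atTop :=
    tendsto_id.const_mul_atTop' two_pos
  have hle : χ + χ ≤ 1 / 2 := by
    refine le_of_tendsto (hlim.comp hdouble) ?_
    filter_upwards [eventually_gt_atTop 0] with k hk
    have hk' : (0 : ℝ) < k := Nat.cast_pos.mpr hk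
    simp only [Function.comp_apply]
    rw [← add_div]
    push_cast
    rw [div_le_iff₀ (by positivity)]
    linarith [hbound k]
  linarith
end

section
/- There exists a Borel probability measure Q on ℝ^{N−1} (N = n+m), invariant under the quotient map g of the junction dynamics, such that for Q-almost every y, the trajectory q^0 = ŷ, q^{k+1} = f(q^k) satisfies: for every coordinate i the limit χ = lim_{k→∞} q^k_i / k exists and is independent of i (the average traffic flow). -/
open MeasureTheory Filter

/-- `hatq n m y = ŷ`, the point of `ℝ^N` (coordinates `1, …, N`, `N = n + m`)
with first coordinate `0` and coordinate `i` equal to `y_{i-1}` for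
`i = 2, …, N`. -/
noncomputable def hatq (n m : ℕ) (y : Fin (n + m - 1) → ℝ) : ℕ → ℝ :=
  fun i => if h : 2 ≤ i ∧ i ≤ n + m then y ⟨i - 2, by omega⟩ else 0

/-- The quotient map of the junction dynamics:
`g(y)_j = f(ŷ)_{j+1} - f(ŷ)_1` for `j = 1, …, N - 1`. -/
noncomputable def junctionG (n m : ℕ) (a : ℕ → ℝ)
    (y : Fin (n + m - 1) → ℝ) : Fin (n + m - 1) → ℝ :=
  fun t => junctionF n m a (hatq n m y) ((t : ℕ) + 2)
    - junctionF n m a (hatq n m y) 1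

/-- A profile that is the minimum of a forward and a backward tight profile satisfies the
eigenvalue equation at interior sections. -/
theorem min_profile_interior {a P q : ℕ → ℝ} {l α β : ℝ} {j : ℕ} (hl : 2 * l ≤ 1)
    (hP : ∀ i, P (i + 1) = P i + a i)
    (hq : ∀ i, j ≤ i → i ≤ j + 2 → q i = P i + min (α - l * i) (β - (1 - l) * i)) :
    min (a j + q j) ((1 - a (j + 1)) + q (j + 2)) = l + q (j + 1) := by
  rw [hq j (by lia) (by lia), hq (j + 1) (by lia) (by lia), hq (j + 2) (by lia) (by lia),
    hP (j + 1), hP j]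
  push_cast
  grind

/-- Boundary data `x = q n`, `y = q (n + 1)`, `z = q (n + m)`, with `q 1 = 0`, that satisfy the
junction equations extend to an additive eigenvector of the junction dynamics. -/
theorem exists_junctionF_eigenvector {n m : ℕ} (hn : 3 ≤ n) (hm : 3 ≤ m) {a P : ℕ → ℝ}
    (hP : ∀ i, P (i + 1) = P i + a i) {l x y z : ℝ} (hl : 2 * l ≤ 1)
    (h_back : 0 ≤ x + (n - 1) * (1 - l) - (P n - P 1))
    (h_first : l = a n + (x + z) / 2)
    (h_second : l + y = min (a (n + m) + (x + z) / 2)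
      (l + (z + (m - 1) * (1 - l) - (P (n + m) - P (n + 1)))))
    (h_end : l + x = min ((1 - a n - a (n + m)) + y - z) (l + (P n - P 1 - (n - 1) * l)))
    (h_end' : l + z = min ((1 - a n - a (n + m)) + y - (l + x))
      (l + (y + (P (n + m) - P (n + 1)) - (m - 1) * l))) :
    ∃ q : ℕ → ℝ, q 1 = 0 ∧
      ∀ i, 1 ≤ i → i ≤ n + m → junctionF n m a q i = l + q i := by
  obtain ⟨q, hq⟩ : ∃ q : ℕ → ℝ, q = fun i : ℕ => if i ≤ n then
      P i + min (l - P 1 - l * i) (x - P n + (1 - l) * n - (1 - l) * i)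
    else P i + min (y - P (n + 1) + l * (n + 1) - l * i)
      (z - P (n + m) + (1 - l) * (n + m) - (1 - l) * i) := ⟨_, rfl⟩
  have hq₁ : ∀ i, i ≤ n → q i =
      P i + min (l - P 1 - l * i) (x - P n + (1 - l) * n - (1 - l) * i) := by
    intro i hi
    rw [hq]
    exact if_pos hi
  have hq₂ : ∀ i, n < i → q i = P i + min (y - P (n + 1) + l * (n + 1) - l * i)
      (z - P (n + m) + (1 - l) * (n + m) - (1 - l) * i) := by
    intro i hi
    rw [hq]
    exact if_neg (by lia)
  clear hq
  have q_one : q 1 = 0 := by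
    rw [hq₁ 1 (by lia), min_eq_left (by push_cast; linarith)]
    push_cast
    ring
  have q_n : q n = x := by
    have := min_le_right ((1 - a n - a (n + m)) + y - z) (l + (P n - P 1 - (n - 1) * l))
    rw [hq₁ n le_rfl, min_eq_right (by linarith)]
    ring
  have q_n1 : q (n + 1) = y := by
    have := min_le_right (a (n + m) + (x + z) / 2)
      (l + (z + (m - 1) * (1 - l) - (P (n + m) - P (n + 1))))
    rw [hq₂ (n + 1) (by lia), min_eq_left (by push_cast; linarith)]
    push_cast
    ring
  have q_nm : q (n + m) = z := by
    have := min_le_right ((1 - a n - a (n + m)) + y - (l + x))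
      (l + (y + (P (n + m) - P (n + 1)) - (m - 1) * l))
    rw [hq₂ (n + m) (by lia), min_eq_right (by push_cast; linarith)]
    push_cast
    ring
  have q_two : (1 - a 1) + q 2 = min (1 - l) (l + (x + (n - 1) * (1 - l) - (P n - P 1))) := by
    rw [hq₁ 2 (by lia), hP 1]
    push_cast
    grind
  have q_n2 : (1 - a (n + 1)) + q (n + 2) =
      min (1 - l + y) (l + (z + (m - 1) * (1 - l) - (P (n + m) - P (n + 1)))) := by
    rw [hq₂ (n + 2) (by lia), hP (n + 1)]
    push_cast
    grind
  have q_pred : a (n - 1) + q (n - 1) = min (l + (P n - P 1 - (n - 1) * l)) (1 - l + x) := by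
    obtain ⟨k, rfl⟩ : ∃ k, n = k + 1 := ⟨n - 1, by lia⟩
    rw [Nat.add_sub_cancel, hq₁ k (by lia), hP k]
    push_cast
    grind
  have q_pred' : a (n + m - 1) + q (n + m - 1) =
      min (l + (y + (P (n + m) - P (n + 1)) - (m - 1) * l)) (1 - l + z) := by
    obtain ⟨k, rfl⟩ : ∃ k, m = k + 1 := ⟨m - 1, by lia⟩
    rw [← add_assoc, Nat.add_sub_cancel, hq₂ (n + k) (by lia), hP (n + k)]
    push_cast
    grind
  have hfn : min ((1 - a n - a (n + m)) + q 1 + q (n + 1) - q (n + m)) (a (n - 1) + q (n - 1))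
      = l + q n := by
    rw [q_one, q_n1, q_nm, q_pred, q_n]
    grind
  refine ⟨q, q_one, fun i hi hi' => ?_⟩
  unfold junctionF
  split_ifs with h₁ h₂ h₃ h₄
  · subst h₁
    rw [q_n, q_nm, q_two, q_one]
    grind
  · subst h₂
    exact hfn
  · subst h₃
    rw [q_n, q_nm, q_n2, q_n1]
    grind
  · subst h₄
    rw [hfn, q_one, q_n1, q_pred', q_nm, q_n, add_zero, ← min_assoc, ← h_end', min_eq_left]
    linarith
  · obtain ⟨j, rfl⟩ : ∃ j, i = j + 1 := ⟨i - 1, by lia⟩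
    rw [Nat.add_sub_cancel]
    rcases lt_or_ge (j + 1) n with h | h
    · exact min_profile_interior hl hP fun i _ _ => hq₁ i (by lia)
    · exact min_profile_interior hl hP fun i _ _ => hq₂ i (by lia)

/-- The junction dynamics has an additive eigenvector. -/
theorem exists_junctionF_eigenvalue {n m : ℕ} (hn : 3 ≤ n) (hm : 3 ≤ m) {a : ℕ → ℝ}
    (ha : ∀ i, 1 ≤ i → i ≤ n + m → 0 ≤ a i ∧ a i ≤ 1) (hjunc : a n + a (n + m) ≤ 1) :
    ∃ (l : ℝ) (q : ℕ → ℝ), q 1 = 0 ∧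
      ∀ i, 1 ≤ i → i ≤ n + m → junctionF n m a q i = l + q i := by
  obtain ⟨P, hP_def⟩ : ∃ P : ℕ → ℝ, P = fun i => ∑ j ∈ Finset.range i, a j := ⟨_, rfl⟩
  have hP : ∀ i, P (i + 1) = P i + a i := by
    intro i
    rw [hP_def]
    exact Finset.sum_range_succ a i
  clear hP_def
  have bound : ∀ s, 1 ≤ s → ∀ k, s + k ≤ n + m →
      0 ≤ P (s + k) - P s ∧ P (s + k) - P s ≤ k := by
    intro s hs k
    induction k with
    | zero => simp
    | succ k ih =>
      intro h
      have h₁ := ih (by lia)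
      have h₂ := ha (s + k) (by lia) (by lia)
      rw [← add_assoc, hP]
      push_cast
      constructor <;> linarith [h₁.1, h₁.2, h₂.1, h₂.2]
  have hn' : (3 : ℝ) ≤ n := by exact_mod_cast hn
  have hm' : (3 : ℝ) ≤ m := by exact_mod_cast hm
  have hA : 0 ≤ P n - P 1 ∧ P n - P 1 ≤ n - 1 := by
    have := bound 1 le_rfl (n - 1) (by lia)
    rwa [Nat.add_sub_of_le (by lia), Nat.cast_sub (by lia), Nat.cast_one] at this
  have hB : 0 ≤ P (n + m) - P (n + 1) ∧ P (n + m) - P (n + 1) ≤ m - 1 := by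
    have := bound (n + 1) (by lia) (m - 1) (by lia)
    rwa [show n + 1 + (m - 1) = n + m by lia, Nat.cast_sub (by lia), Nat.cast_one] at this
  have han := ha n (by lia) (by lia)
  have hanm := ha (n + m) (by lia) (by lia)
  obtain ⟨A, hA_def⟩ : ∃ A, A = P n - P 1 := ⟨_, rfl⟩
  obtain ⟨B, hB_def⟩ : ∃ B, B = P (n + m) - P (n + 1) := ⟨_, rfl⟩
  obtain ⟨T, hT⟩ : ∃ T, T = A + B + a n + a (n + m) := ⟨_, rfl⟩
  have key := fun l x y z => @exists_junctionF_eigenvector n m hn hm a P hP l x y z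
  rw [← hA_def] at hA
  rw [← hB_def] at hB
  simp only [← hA_def, ← hB_def] at key
  clear hA_def hB_def bound hP ha
  obtain ⟨hA₀, hA₁⟩ := hA
  obtain ⟨hB₀, hB₁⟩ := hB
  obtain ⟨han₀, han₁⟩ := han
  obtain ⟨hanm₀, hanm₁⟩ := hanm
  generalize a n = b at *
  generalize a (n + m) = c at *
  generalize (n : ℝ) = u at *
  generalize (m : ℝ) = v at *
  rcases le_total v T with hIV | hIV
  · refine ⟨0, key 0 (v - b - c - B) (c - b - 1) (B + c - b - v) ?_ ?_ ?_ ?_ ?_ ?_⟩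
    · linarith
    · linarith
    · linarith
    · rw [min_eq_right] <;> linarith
    · rw [min_eq_left] <;> linarith
    · rw [min_eq_left] <;> linarith
  rcases le_total (4 * T) (u + v) with hI | hI
  · obtain ⟨l, hl⟩ : ∃ l, l * (u + v) = T := ⟨T / (u + v), div_mul_cancel₀ _ (by linarith)⟩
    have hl₀ : 0 ≤ l := by nlinarith
    have hl₁ : 4 * l ≤ 1 := by nlinarith
    refine ⟨l, key l (A - (u - 1) * l) (c - b) ((u + 1) * l - 2 * b - A) ?_ ?_ ?_ ?_ ?_ ?_⟩
    · linarith
    · nlinarith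
    · linarith
    · rw [min_eq_left] <;> nlinarith
    · rw [min_eq_right] <;> linarith
    · rw [min_eq_right] <;> linarith
  rcases le_total (4 * T) (u + 3 * v - 2) with hII | hII
  · refine ⟨1 / 4, key (1 / 4) (A - (u - 1) * (1 / 4)) (c - b)
      ((u + 1) * (1 / 4) - 2 * b - A) ?_ ?_ ?_ ?_ ?_ ?_⟩
    · linarith
    · linarith
    · linarith
    · rw [min_eq_left] <;> linarith
    · rw [min_eq_right] <;> linarith
    · rw [min_eq_left] <;> linarith
  rcases eq_or_lt_of_le (show 0 ≤ v + 2 - u by linarith) with hd | hd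
  · refine ⟨1 / 4, key (1 / 4) (A - (u - 1) * (1 / 4)) (c - b)
      ((u + 1) * (1 / 4) - 2 * b - A) ?_ ?_ ?_ ?_ ?_ ?_⟩
    · linarith
    · linarith
    · linarith
    · rw [min_eq_left] <;> linarith
    · rw [min_eq_right] <;> linarith
    · rw [min_eq_left] <;> linarith
  obtain ⟨l, hl⟩ : ∃ l, l * (v + 2 - u) = v - T :=
    ⟨(v - T) / (v + 2 - u), div_mul_cancel₀ _ hd.ne'⟩
  have hl₀ : 0 ≤ l := by
    by_contra! h
    nlinarith
  have hl₁ : 4 * l ≤ 1 := by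
    by_contra! h
    nlinarith
  refine ⟨l, key l (A - (u - 1) * l) (4 * l - 1 - b + c)
    ((u + 1) * l - 2 * b - A) ?_ ?_ ?_ ?_ ?_ ?_⟩
  · linarith
  · nlinarith
  · linarith
  · rw [min_eq_right] <;> linarith
  · rw [min_eq_right] <;> linarith
  · rw [min_eq_left]
    · linarith
    · nlinarith

/-- The junction dynamics is additively homogeneous and depends only on the coordinates
`1, …, n + m`. -/
theorem junctionF_congr_add {n m : ℕ} (hn : 3 ≤ n) (hm : 3 ≤ m) {a p q : ℕ → ℝ} {c : ℝ}
    (h : ∀ i, 1 ≤ i → i ≤ n + m → p i = c + q i) {i : ℕ} (hi : 1 ≤ i) (hi' : i ≤ n + m) :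
    junctionF n m a p i = c + junctionF n m a q i := by
  have h₁ := h 1 (by lia) (by lia)
  have h₂ := h n (by lia) (by lia)
  have h₃ := h (n + 1) (by lia) (by lia)
  have h₄ := h (n + m) (by lia) (by lia)
  have h₅ := h (n - 1) (by lia) (by lia)
  have h₆ := h (n + m - 1) (by lia) (by lia)
  unfold junctionF
  split_ifs with c₁ c₂ c₃ c₄
  · rw [h₂, h₄, h 2 (by lia) (by lia), ← min_add_add_left]
    congr 1 <;> ring
  · rw [h₁, h₃, h₄, h₅, ← min_add_add_left]
    congr 1 <;> ring
  · rw [h₂, h₄, h (n + 2) (by lia) (by lia), ← min_add_add_left]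
    congr 1 <;> ring
  · rw [h₁, h₃, h₄, h₅, h₆]
    grind
  · rw [h (i - 1) (by lia) (by lia), h (i + 1) (by lia) (by lia), ← min_add_add_left]
    congr 1 <;> ring

theorem measurable_hatq_apply (n m i : ℕ) : Measurable fun y => hatq n m y i := by
  unfold hatq
  split_ifs
  · exact measurable_pi_apply _
  · exact measurable_const

theorem measurable_junctionF_hatq_apply (n m : ℕ) (a : ℕ → ℝ) (i : ℕ) :
    Measurable fun y => junctionF n m a (hatq n m y) i := by
  have h := measurable_hatq_apply n m
  unfold junctionF
  split_ifs <;> fun_prop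

theorem measurable_junctionG (n m : ℕ) (a : ℕ → ℝ) : Measurable (junctionG n m a) :=
  measurable_pi_lambda _ fun _ =>
    (measurable_junctionF_hatq_apply n m a _).sub (measurable_junctionF_hatq_apply n m a 1)

/-- there is a Borel probability measure invariant under the
quotient map of the junction dynamics such that, almost surely in the initial
condition `ŷ`, the average traffic flow `χ = lim_k q^k_i / k` exists and is the
same for every coordinate. -/
theorem junction_invariant_measure_growth_rate (n m : ℕ) (hn : 3 ≤ n) (hm : 3 ≤ m)
    (a : ℕ → ℝ) (ha : ∀ i, 1 ≤ i → i ≤ n + m → 0 ≤ a i ∧ a i ≤ 1)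
    (hjunc : a n + a (n + m) ≤ 1) :
    ∃ Q : Measure (Fin (n + m - 1) → ℝ), IsProbabilityMeasure Q ∧
      MeasurePreserving (junctionG n m a) Q Q ∧
      ∀ᵐ y ∂Q, ∃ χ : ℝ, ∀ i, 1 ≤ i → i ≤ n + m →
        Tendsto (fun k : ℕ => ((junctionF n m a)^[k] (hatq n m y)) i / k) atTop
          (nhds χ) := by
  obtain ⟨l, q, hq₁, hq⟩ := exists_junctionF_eigenvalue hn hm ha hjunc
  obtain ⟨y, hy⟩ : ∃ y : Fin (n + m - 1) → ℝ, y = fun t : Fin (n + m - 1) => q ((t : ℕ) + 2) := ⟨_, rfl⟩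
  have hat : ∀ i, 1 ≤ i → i ≤ n + m → hatq n m y i = q i := by
    intro i hi hi'
    unfold hatq
    split_ifs with h
    · rw [hy]
      exact congrArg q (Nat.sub_add_cancel h.1)
    · rw [show i = 1 by lia, hq₁]
  have iter : ∀ k : ℕ, ∀ i, 1 ≤ i → i ≤ n + m →
      (junctionF n m a)^[k] (hatq n m y) i = k * l + q i := by
    intro k
    induction k with
    | zero => simpa using hat
    | succ k ih =>
      intro i hi hi'
      rw [Function.iterate_succ_apply', junctionF_congr_add hn hm ih hi hi', hq i hi hi']
      push_cast
      ring
  have fixed : junctionG n m a y = y := by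
    funext t
    have h₁ := iter 1 ((t : ℕ) + 2) (by lia) (by lia)
    have h₂ := iter 1 1 (by lia) (by lia)
    rw [Function.iterate_one] at h₁ h₂
    unfold junctionG
    rw [h₁, h₂, hq₁, hy]
    ring
  refine ⟨Measure.dirac y, inferInstance, ⟨measurable_junctionG n m a, ?_⟩, ?_⟩
  · rw [Measure.map_dirac' (measurable_junctionG n m a), fixed]
  · rw [ae_dirac_eq]
    refine ⟨l, fun i hi hi' => ?_⟩
    have h : Tendsto (fun k : ℕ => l + q i / k) atTop (nhds (l + 0)) :=
      tendsto_const_nhds.add (tendsto_const_div_atTop_nhds_zero_nat (q i))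
    rw [add_zero] at h
    refine h.congr' ?_
    filter_upwards [eventually_gt_atTop 0] with k hk
    have hk' : (k : ℝ) ≠ 0 := by exact_mod_cast hk.ne'
    rw [iter k i hi hi']
    field_simp
end

section
/- If (λ, q) ∈ ℝ × ℝ^{n+m} is a solution of the junction eigenvalue problem, then λ ≤ 1/4. -/
/-- any solution `(λ, q)` of the junction eigenvalue problem
satisfies `λ ≤ 1/4`. -/
theorem junction_eigenvalue_le_quarter (n m : ℕ) (hn : 3 ≤ n) (hm : 3 ≤ m)
    (a : ℕ → ℝ) (ha : ∀ i, 1 ≤ i → i ≤ n + m → 0 ≤ a i ∧ a i ≤ 1)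
    (hjunc : a n + a (n + m) ≤ 1)
    (lam : ℝ) (q : ℕ → ℝ)
    (heq : ∀ i, 2 ≤ i → i ≤ n + m - 1 → i ≠ n → i ≠ n + 1 →
      lam + q i = min (a (i - 1) + q (i - 1)) ((1 - a i) + q (i + 1)))
    (heqn : lam + q n
      = min ((1 - a n - a (n + m)) + q 1 + q (n + 1) - q (n + m))
          (a (n - 1) + q (n - 1)))
    (heqnm : lam + q (n + m)
      = min ((1 - a n - a (n + m)) + q 1 + q (n + 1) - (lam + q n))
          (a (n + m - 1) + q (n + m - 1)))
    (heq1 : lam + q 1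
      = min (a n + (q n + q (n + m)) / 2) ((1 - a 1) + q 2))
    (heqn1 : lam + q (n + 1)
      = min (a (n + m) + (q n + q (n + m)) / 2) ((1 - a (n + 1)) + q (n + 2))) :
    lam ≤ 1 / 4 := by
  have h₁ := heq1.trans_le (min_le_left _ _)
  have h₂ := heqn1.trans_le (min_le_left _ _)
  have h₃ := heqnm.trans_le (min_le_left _ _)
  linarith
end

section
/- Let p ≥ 2 be an integer, let λ < 1/2 be real, let a_1, …, a_{p−1} ∈ [0,1], and let q_1, q_p ∈ ℝ be given boundary values. Then reals q_2, …, q_{p−1} satisfy the minplus linear equations λ + q_i = min(a_{i−1} + q_{i−1}, (1 − a_i) + q_{i+1}) for all i = 2, …, p−1 if and only if they are given by the explicit formulas q_i = min( q_1 + ∑_{j=1}^{i−1} a_j − (i−1)λ , q_p + ∑_{j=i}^{p−1} (1 − a_j) − (p−i)λ ) for all i = 2, …, p−1. In particular this linear minplus system has a unique solution when λ < 1/2. -/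
/-- Solutions of a two-sided minplus recursion, in terms of the forward values `F` and the
backward values `B` obtained by propagating from either end alone. -/
theorem minplus_recursion_iff {p : ℕ} {lam : ℝ} (hlam : lam < 1 / 2) {a q F B : ℕ → ℝ}
    (hF1 : F 1 = q 1) (hF : ∀ i, 1 ≤ i → F (i + 1) = F i + a i - lam)
    (hBp : B p = q p) (hB : ∀ i, i < p → B i = B (i + 1) + (1 - a i) - lam) :
    (∀ i, 2 ≤ i → i < p → lam + q i = min (a (i - 1) + q (i - 1)) ((1 - a i) + q (i + 1))) ↔
      ∀ i, 2 ≤ i → i < p → q i = min (F i) (B i) := by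
  constructor
  · intro h
    have le_F : ∀ i, 1 ≤ i → i < p → q i ≤ F i := by
      intro i hi
      induction i, hi using Nat.le_induction with
      | base => exact fun _ => hF1.ge
      | succ n hn ih =>
        intro hnp
        have h1 := h (n + 1) (by omega) hnp
        have h2 := min_le_left (a n + q n) ((1 - a (n + 1)) + q (n + 1 + 1))
        rw [Nat.add_sub_cancel] at h1
        linarith [ih (by omega), hF n hn]
    have le_B : ∀ i, i ≤ p → 2 ≤ i → q i ≤ B i := by
      intro i hi
      induction hi using Nat.decreasingInduction with
      | self => exact fun _ => hBp.ge
      | of_succ n hn ih =>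
        intro hn2
        have h1 := h n hn2 hn
        have h2 := min_le_right (a (n - 1) + q (n - 1)) ((1 - a n) + q (n + 1))
        linarith [ih (by omega), hB n hn]
    -- A tight right term at `i` and a tight left term at `i + 1` would close a loop of
    -- weight `1 - 2 * lam > 0`, so tightness on the right propagates to the right.
    have step : ∀ n, 2 ≤ n → n + 1 < p → lam + q n = (1 - a n) + q (n + 1) →
        lam + q (n + 1) = (1 - a (n + 1)) + q (n + 1 + 1) := by
      intro n hn hnp hR
      have h1 := h (n + 1) (by omega) hnp
      rw [Nat.add_sub_cancel] at h1
      rcases min_choice (a n + q n) ((1 - a (n + 1)) + q (n + 1 + 1)) with h2 | h2 <;> linarith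
    have eq_B : ∀ i, i ≤ p → 2 ≤ i →
        (i < p → lam + q i = (1 - a i) + q (i + 1)) → q i = B i := by
      intro i hi
      induction hi using Nat.decreasingInduction with
      | self => exact fun _ _ => hBp.symm
      | of_succ n hn ih =>
        intro hn2 hR
        have h1 := ih (by omega) fun hnp => step n hn2 hnp (hR hn)
        linarith [hR hn, hB n hn]
    have eq_F : ∀ i, 1 ≤ i → i < p →
        (2 ≤ i → lam + q i ≠ (1 - a i) + q (i + 1)) → q i = F i := by
      intro i hi
      induction i, hi using Nat.le_induction with
      | base => exact fun _ _ => hF1.symm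
      | succ n hn ih =>
        intro hnp hR
        have h1 := ih (by omega) fun hn2 hRn => hR (by omega) (step n hn2 hnp hRn)
        have h2 := h (n + 1) (by omega) hnp
        rw [Nat.add_sub_cancel] at h2
        rcases min_choice (a n + q n) ((1 - a (n + 1)) + q (n + 1 + 1)) with h3 | h3
        · linarith [hF n hn]
        · exact absurd (h2.trans h3) (hR (by omega))
    intro i hi hip
    by_cases hR : lam + q i = (1 - a i) + q (i + 1)
    · have h1 := eq_B i hip.le hi fun _ => hR
      rw [min_eq_right (h1 ▸ le_F i (by omega) hip), h1]
    · have h1 := eq_F i (by omega) hip fun _ => hR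
      rw [min_eq_left (h1 ▸ le_B i hip.le hi), h1]
  · intro h i hi hip
    obtain ⟨n, rfl⟩ : ∃ n, i = n + 1 := ⟨i - 1, by omega⟩
    rw [Nat.add_sub_cancel, h (n + 1) hi hip]
    have hFn := hF n (by omega)
    have hFn' := hF (n + 1) (by omega)
    have hBn := hB n (by omega)
    have hBn' := hB (n + 1) hip
    have left : q n = F n ∨ q n = min (F n) (B n) := by
      rcases Nat.lt_or_ge n 2 with hn | hn
      · obtain rfl : n = 1 := by omega
        exact .inl hF1.symm
      · exact .inr (h n hn (by omega))
    have right : q (n + 1 + 1) = B (n + 1 + 1) ∨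
        q (n + 1 + 1) = min (F (n + 1 + 1)) (B (n + 1 + 1)) := by
      rcases Nat.lt_or_ge (n + 1 + 1) p with hn | hn
      · exact .inr (h _ (by omega) hn)
      · obtain rfl : p = n + 1 + 1 := by omega
        exact .inl hBp.symm
    grind


/-- elimination of the interior variables of a road segment.
For `λ < 1/2`, the interior values `q_2, …, q_{p-1}` satisfy the minplus linear
equations iff they are given by the explicit formulas; in particular the
minplus linear system has a unique solution. -/
theorem road_segment_elimination (p : ℕ) (hp : 2 ≤ p)
    (lam : ℝ) (hlam : lam < 1 / 2)
    (a : ℕ → ℝ) (ha : ∀ j, 1 ≤ j → j ≤ p - 1 → 0 ≤ a j ∧ a j ≤ 1)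
    (q : ℕ → ℝ) :
    (∀ i, 2 ≤ i → i ≤ p - 1 →
        lam + q i = min (a (i - 1) + q (i - 1)) ((1 - a i) + q (i + 1)))
      ↔
    (∀ i, 2 ≤ i → i ≤ p - 1 →
        q i = min (q 1 + (∑ j ∈ Finset.Icc 1 (i - 1), a j) - ((i : ℝ) - 1) * lam)
          (q p + (∑ j ∈ Finset.Icc i (p - 1), (1 - a j)) - ((p : ℝ) - (i : ℝ)) * lam)) := by
  have lt_iff : ∀ i, i ≤ p - 1 ↔ i < p := fun i => by omega
  simp only [lt_iff]
  refine minplus_recursion_iff hlam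
    (F := fun i => q 1 + (∑ j ∈ Finset.Icc 1 (i - 1), a j) - ((i : ℝ) - 1) * lam)
    (B := fun i => q p + (∑ j ∈ Finset.Icc i (p - 1), (1 - a j)) - ((p : ℝ) - (i : ℝ)) * lam)
    (by simp) (fun i hi => ?_) ?_ (fun i hi => ?_)
  · obtain ⟨n, rfl⟩ : ∃ n, i = n + 1 := ⟨i - 1, by omega⟩
    simp only [Nat.add_sub_cancel, Finset.sum_Icc_succ_top (Nat.le_add_left 1 n)]
    push_cast
    ring
  · simp [Finset.Icc_eq_empty_of_lt (show p - 1 < p by omega)]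
  · simp only [← Finset.add_sum_Ioc_eq_sum_Icc (show i ≤ p - 1 by omega),
      ← Finset.Icc_add_one_left_eq_Ioc]
    push_cast
    ring
end

section
/- Free-moving phase: In the reduced junction eigenvalue system, set λ = (g + h + k + l)/(n' + m' + 2) and assume 0 ≤ λ ≤ 1/4. Then the quadruple (U, V, X, Y) = (g − n'λ, (n'+2)λ − 2k − g, 0, l − k) is a solution of the reduced junction eigenvalue system with eigenvalue λ. -/
/-- free-moving phase: with `λ = (g+h+k+l)/(n'+m'+2)` and
`0 ≤ λ ≤ 1/4`, the quadruple `(U,V,X,Y) = (g - n'λ, (n'+2)λ - 2k - g, 0, l - k)`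
solves the reduced junction eigenvalue system. -/
theorem reduced_eigen_free_phase (n' m' : ℕ) (hn' : 1 ≤ n') (hm' : 1 ≤ m')
    (g h k l : ℝ) (hg0 : 0 ≤ g) (hg1 : g ≤ (n' : ℝ)) (hh0 : 0 ≤ h) (hh1 : h ≤ (m' : ℝ))
    (hk0 : 0 ≤ k) (hl0 : 0 ≤ l) (hkl : k + l ≤ 1)
    (lam : ℝ) (hlam : lam = (g + h + k + l) / ((n' : ℝ) + (m' : ℝ) + 2))
    (hlam0 : 0 ≤ lam) (hlam4 : lam ≤ 1 / 4) :
    let U : ℝ := g - (n' : ℝ) * lam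
    let V : ℝ := ((n' : ℝ) + 2) * lam - 2 * k - g
    let X : ℝ := 0
    let Y : ℝ := l - k
    U = min ((1 - k - l) + X + Y - lam - V) (g + X - (n' : ℝ) * lam) ∧
    V = min ((1 - k - l) + X + Y - 2 * lam - U) (h + Y - (m' : ℝ) * lam) ∧
    X = min (k + (U + V) / 2 - lam) (((n' : ℝ) - g) + U - (n' : ℝ) * lam) ∧
    Y = min (l + (U + V) / 2 - lam) (((m' : ℝ) - h) + V - (m' : ℝ) * lam) := by
  intro U V X Y
  have hflow : lam * ((n' : ℝ) + m' + 2) = g + h + k + l := by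
    rw [hlam]
    exact div_mul_cancel₀ _ (by positivity)
  have hn : 0 ≤ (n' : ℝ) * (1 - 2 * lam) := mul_nonneg n'.cast_nonneg (by linarith)
  have hm : 0 ≤ (m' : ℝ) * (1 - 2 * lam) := mul_nonneg m'.cast_nonneg (by linarith)
  dsimp only [U, V, X, Y]
  refine ⟨?_, ?_, ?_, ?_⟩
  · rw [min_eq_right] <;> linarith
  · rw [min_eq_right] <;> linarith
  · rw [min_eq_left] <;> linarith
  · rw [min_eq_left] <;> linarith
end

section
/- Saturation phase: In the reduced junction eigenvalue system, set λ = 1/4 and assume (n' + m' + 2)/4 ≤ g + h + k + l ≤ m' + (n' + 2 − m')/4. Then the quadruple (U, V, X, Y) = (g − n'/4, (n'+2)/4 − 2k − g, 0, l − k) is a solution of the reduced junction eigenvalue system with eigenvalue λ = 1/4. -/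
/-- saturation phase: with `λ = 1/4` and
`(n'+m'+2)/4 ≤ g+h+k+l ≤ m' + (n'+2-m')/4`, the quadruple
`(U,V,X,Y) = (g - n'/4, (n'+2)/4 - 2k - g, 0, l - k)` solves the reduced
junction eigenvalue system with eigenvalue `1/4`. -/
theorem reduced_eigen_saturation_phase (n' m' : ℕ) (hn' : 1 ≤ n') (hm' : 1 ≤ m')
    (g h k l : ℝ) (hg0 : 0 ≤ g) (hg1 : g ≤ (n' : ℝ)) (hh0 : 0 ≤ h) (hh1 : h ≤ (m' : ℝ))
    (hk0 : 0 ≤ k) (hl0 : 0 ≤ l) (hkl : k + l ≤ 1)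
    (hlow : ((n' : ℝ) + (m' : ℝ) + 2) / 4 ≤ g + h + k + l)
    (hhigh : g + h + k + l ≤ (m' : ℝ) + ((n' : ℝ) + 2 - (m' : ℝ)) / 4) :
    let lam : ℝ := 1 / 4
    let U : ℝ := g - (n' : ℝ) * lam
    let V : ℝ := ((n' : ℝ) + 2) * lam - 2 * k - g
    let X : ℝ := 0
    let Y : ℝ := l - k
    U = min ((1 - k - l) + X + Y - lam - V) (g + X - (n' : ℝ) * lam) ∧
    V = min ((1 - k - l) + X + Y - 2 * lam - U) (h + Y - (m' : ℝ) * lam) ∧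
    X = min (k + (U + V) / 2 - lam) (((n' : ℝ) - g) + U - (n' : ℝ) * lam) ∧
    Y = min (l + (U + V) / 2 - lam) (((m' : ℝ) - h) + V - (m' : ℝ) * lam) := by
  have hn0 : (0 : ℝ) ≤ n' := n'.cast_nonneg
  intro lam U V X Y
  simp only [lam, U, V, X, Y]
  refine ⟨?_, ?_, ?_, ?_⟩
  · rw [min_eq_right] <;> linarith
  · rw [min_eq_left] <;> linarith
  · rw [min_eq_left] <;> linarith
  · rw [min_eq_left] <;> linarith
end

section
/- Recession phase: In the reduced junction eigenvalue system, assume m' − n' + 2 ≠ 0, set λ = (m' + 1 − (g + h + k + l))/(m' − n' + 2), and assume 0 ≤ λ ≤ 1/4. Then the quadruple (U, V, X, Y) = (g − n'λ, (n'+2)λ − 2k − g, 0, 4λ − 1 + l − k) is a solution of the reduced junction eigenvalue system with eigenvalue λ. -/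
/-- recession phase: with `m' - n' + 2 ≠ 0`,
`λ = (m' + 1 - (g+h+k+l))/(m' - n' + 2)` and `0 ≤ λ ≤ 1/4`, the quadruple
`(U,V,X,Y) = (g - n'λ, (n'+2)λ - 2k - g, 0, 4λ - 1 + l - k)` solves the
reduced junction eigenvalue system with eigenvalue `λ`. -/
theorem reduced_eigen_recession_phase (n' m' : ℕ) (hn' : 1 ≤ n') (hm' : 1 ≤ m')
    (g h k l : ℝ) (hg0 : 0 ≤ g) (hg1 : g ≤ (n' : ℝ)) (hh0 : 0 ≤ h) (hh1 : h ≤ (m' : ℝ))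
    (hk0 : 0 ≤ k) (hl0 : 0 ≤ l) (hkl : k + l ≤ 1)
    (hden : (m' : ℝ) - (n' : ℝ) + 2 ≠ 0)
    (lam : ℝ)
    (hlam : lam = ((m' : ℝ) + 1 - (g + h + k + l)) / ((m' : ℝ) - (n' : ℝ) + 2))
    (hlam0 : 0 ≤ lam) (hlam4 : lam ≤ 1 / 4) :
    let U : ℝ := g - (n' : ℝ) * lam
    let V : ℝ := ((n' : ℝ) + 2) * lam - 2 * k - g
    let X : ℝ := 0
    let Y : ℝ := 4 * lam - 1 + l - k
    U = min ((1 - k - l) + X + Y - lam - V) (g + X - (n' : ℝ) * lam) ∧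
    V = min ((1 - k - l) + X + Y - 2 * lam - U) (h + Y - (m' : ℝ) * lam) ∧
    X = min (k + (U + V) / 2 - lam) (((n' : ℝ) - g) + U - (n' : ℝ) * lam) ∧
    Y = min (l + (U + V) / 2 - lam) (((m' : ℝ) - h) + V - (m' : ℝ) * lam) := by
  have hmass : lam * ((m' : ℝ) - n' + 2) = m' + 1 - (g + h + k + l) := by
    rw [hlam, div_mul_cancel₀ _ hden]
  have hn : (n' : ℝ) * lam ≤ n' * (1 / 4) := mul_le_mul_of_nonneg_left hlam4 n'.cast_nonneg
  have hm : (m' : ℝ) * lam ≤ m' * (1 / 4) := mul_le_mul_of_nonneg_left hlam4 m'.cast_nonneg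
  have hn0 : (0 : ℝ) ≤ n' := n'.cast_nonneg
  have hm0 : (0 : ℝ) ≤ m' := m'.cast_nonneg
  intro U V X Y
  simp only [U, V, X, Y]
  refine ⟨?_, ?_, ?_, ?_⟩
  · rw [min_eq_right (by linarith)]
    ring
  · rw [min_eq_left (by linarith)]
    ring
  · rw [min_eq_left (by linarith)]
    ring
  · rw [min_eq_right (by linarith)]
    linarith
end

section
/- Freeze phase: In the reduced junction eigenvalue system, assume g + h + k + l ≥ m' + 1. Then λ = 0 is an eigenvalue: the quadruple (U, V, X, Y) = (k̄ + h̄, −2k − k̄ − h̄, 0, −2k − k̄) is a solution of the reduced junction eigenvalue system with λ = 0. -/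
/-- freeze phase: if `g + h + k + l ≥ m' + 1`, then `λ = 0` is an
eigenvalue of the reduced junction eigenvalue system, with eigenvector
`(U,V,X,Y) = (k̄ + h̄, -2k - k̄ - h̄, 0, -2k - k̄)` where `k̄ = 1 - k - l` and
`h̄ = m' - h`. -/
theorem reduced_eigen_freeze_phase (n' m' : ℕ) (hn' : 1 ≤ n') (hm' : 1 ≤ m')
    (g h k l : ℝ) (hg0 : 0 ≤ g) (hg1 : g ≤ (n' : ℝ)) (hh0 : 0 ≤ h) (hh1 : h ≤ (m' : ℝ))
    (hk0 : 0 ≤ k) (hl0 : 0 ≤ l) (hkl : k + l ≤ 1)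
    (hfull : (m' : ℝ) + 1 ≤ g + h + k + l) :
    let lam : ℝ := 0
    let U : ℝ := (1 - k - l) + ((m' : ℝ) - h)
    let V : ℝ := -2 * k - (1 - k - l) - ((m' : ℝ) - h)
    let X : ℝ := 0
    let Y : ℝ := -2 * k - (1 - k - l)
    U = min ((1 - k - l) + X + Y - lam - V) (g + X - (n' : ℝ) * lam) ∧
    V = min ((1 - k - l) + X + Y - 2 * lam - U) (h + Y - (m' : ℝ) * lam) ∧
    X = min (k + (U + V) / 2 - lam) (((n' : ℝ) - g) + U - (n' : ℝ) * lam) ∧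
    Y = min (l + (U + V) / 2 - lam) (((m' : ℝ) - h) + V - (m' : ℝ) * lam) := by
  intro lam U V X Y
  refine ⟨?_, ?_, ?_, ?_⟩
  · rw [min_eq_left] <;> simp only [lam, U, V, X, Y] <;> linarith
  · rw [min_eq_left] <;> simp only [lam, U, V, X, Y] <;> linarith
  · rw [min_eq_left] <;> simp only [lam, U, V, X, Y] <;> linarith
  · rw [min_eq_right] <;> simp only [lam, U, V, X, Y] <;> linarith
end

section
/- Free-moving phase of the full junction: let s = ∑_{i=1}^{n+m} a_i be the total number of cars and assume s ≤ (n+m)/4. Then λ = s/(n+m) = (1 − ρ)d is an eigenvalue of the junction eigenvalue problem: there exists q ∈ ℝ^{n+m} such that (λ, q) solves the junction eigenvalue problem, where ρ = 1/(n+m) and d = s/(n+m−1) is the density of vehicles. -/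
/-- The junction eigenvalue problem for two circular roads of `n` and `m`
sections with one junction: `(λ, q)` is a solution when all the minplus
eigenvalue equations hold.  Here `ā_i = 1 - a_i` for `i ∉ {n, n+m}` and
`ā_n = ā_{n+m} = 1 - a_n - a_{n+m}`. -/
def JunctionEigen (n m : ℕ) (a : ℕ → ℝ) (lam : ℝ) (q : ℕ → ℝ) : Prop :=
  (∀ i, 2 ≤ i → i ≤ n + m - 1 → i ≠ n → i ≠ n + 1 →
    lam + q i = min (a (i - 1) + q (i - 1)) ((1 - a i) + q (i + 1))) ∧
  (lam + q n
    = min ((1 - a n - a (n + m)) + q 1 + q (n + 1) - q (n + m))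
        (a (n - 1) + q (n - 1))) ∧
  (lam + q (n + m)
    = min ((1 - a n - a (n + m)) + q 1 + q (n + 1) - (lam + q n))
        (a (n + m - 1) + q (n + m - 1))) ∧
  (lam + q 1 = min (a n + (q n + q (n + m)) / 2) ((1 - a 1) + q 2)) ∧
  (lam + q (n + 1)
    = min (a (n + m) + (q n + q (n + m)) / 2) ((1 - a (n + 1)) + q (n + 2)))

/-- The profile that gains `a i - lam` from section `i` to section `i + 1` on each road, with the
offset `a (n + m) - a n` between the entries of the two roads. -/
noncomputable def freeProfile (n m : ℕ) (a : ℕ → ℝ) (lam : ℝ) (i : ℕ) : ℝ :=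
  if i ≤ n then ∑ j ∈ Finset.Ico 1 i, (a j - lam)
  else a (n + m) - a n + ∑ j ∈ Finset.Ico (n + 1) i, (a j - lam)

theorem freeProfile_succ (n m : ℕ) (a : ℕ → ℝ) (lam : ℝ) {i : ℕ} (hi : 1 ≤ i) (hin : i ≠ n) :
    freeProfile n m a lam (i + 1) = freeProfile n m a lam i + (a i - lam) := by
  unfold freeProfile
  rcases lt_or_gt_of_ne hin with h | h
  · rw [if_pos (by omega), if_pos (by omega), Finset.sum_Ico_succ_top hi]
  · rw [if_neg (by omega), if_neg (by omega), Finset.sum_Ico_succ_top (by omega), add_assoc]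

theorem sum_Icc_eq_add_sum_Ico {n m : ℕ} (hn : 1 ≤ n) (hm : 1 ≤ m) (f : ℕ → ℝ) :
    ∑ i ∈ Finset.Icc 1 (n + m), f i =
      ∑ i ∈ Finset.Ico 1 n, f i + f n + ∑ i ∈ Finset.Ico (n + 1) (n + m), f i + f (n + m) := by
  rw [← Finset.Ico_add_one_right_eq_Icc, Finset.sum_Ico_succ_top (by omega),
    ← Finset.sum_Ico_consecutive f (show 1 ≤ n + 1 by omega) (show n + 1 ≤ n + m by omega),
    Finset.sum_Ico_succ_top hn]

/-- If the total excess of `a` over `lam` vanishes, so does the gain of the profile around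
both roads. -/
theorem freeProfile_balance {n m : ℕ} (hn : 1 ≤ n) (hm : 1 ≤ m) (a : ℕ → ℝ) (lam : ℝ)
    (hlam : ∑ i ∈ Finset.Icc 1 (n + m), (a i - lam) = 0) :
    freeProfile n m a lam n + freeProfile n m a lam (n + m) =
      freeProfile n m a lam 1 + freeProfile n m a lam (n + 1)
        + 2 * lam - a n - a (n + m) := by
  rw [sum_Icc_eq_add_sum_Ico hn hm] at hlam
  have hm0 : m ≠ 0 := by omega
  simp [freeProfile, hn, hm0, -Finset.sum_sub_distrib]
  linarith

theorem freeProfile_entry_sub {n : ℕ} (hn : 1 ≤ n) (m : ℕ) (a : ℕ → ℝ) (lam : ℝ) :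
    freeProfile n m a lam (n + 1) - freeProfile n m a lam 1 = a (n + m) - a n := by
  simp [freeProfile, hn]

theorem junctionEigen_freeProfile {n m : ℕ} (hn : 2 ≤ n) (hm : 2 ≤ m) (a : ℕ → ℝ) {lam : ℝ}
    (hlam : ∑ i ∈ Finset.Icc 1 (n + m), (a i - lam) = 0) (hle : lam ≤ 1 / 4) :
    JunctionEigen n m a lam (freeProfile n m a lam) := by
  have hbal := freeProfile_balance (by omega) (by omega) a lam hlam
  have hoff := freeProfile_entry_sub (show 1 ≤ n by omega) m a lam
  have hsucc : ∀ i, 1 ≤ i → i ≠ n → freeProfile n m a lam (i + 1) =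
      freeProfile n m a lam i + (a i - lam) := fun i => freeProfile_succ n m a lam
  have hpred : ∀ i, 2 ≤ i → i ≠ n + 1 → freeProfile n m a lam i =
      freeProfile n m a lam (i - 1) + (a (i - 1) - lam) := fun i hi hin => by
    have h := hsucc (i - 1) (by omega) (by omega)
    rwa [Nat.sub_add_cancel (by omega)] at h
  refine ⟨fun i hi _ hin hin' => ?_, ?_, ?_, ?_, ?_⟩
  · have h := hpred i hi hin'
    have h' := hsucc i (by omega) hin
    rw [min_eq_left (by linarith)]
    linarith
  · have h := hpred n hn (by omega)
    rw [min_eq_right (by linarith)]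
    linarith
  · have h := hpred (n + m) (by omega) (by omega)
    rw [min_eq_right (by linarith)]
    linarith
  · have h : freeProfile n m a lam 2 = _ := hsucc 1 le_rfl (by omega)
    rw [min_eq_left (by linarith)]
    linarith
  · have h : freeProfile n m a lam (n + 2) = _ := hsucc (n + 1) (by omega) (by omega)
    rw [min_eq_left (by linarith)]
    linarith

/-- free-moving phase of the full junction: if the total number
of cars `s = ∑_{i=1}^{n+m} a_i` satisfies `s ≤ (n+m)/4`, then
`λ = s/(n+m) = (1-ρ)d` is an eigenvalue of the junction eigenvalue problem. -/
theorem junction_eigen_free_phase (n m : ℕ) (hn : 3 ≤ n) (hm : 3 ≤ m)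
    (a : ℕ → ℝ) (ha : ∀ i, 1 ≤ i → i ≤ n + m → 0 ≤ a i ∧ a i ≤ 1)
    (hjunc : a n + a (n + m) ≤ 1)
    (hs : (∑ i ∈ Finset.Icc 1 (n + m), a i) ≤ ((n : ℝ) + (m : ℝ)) / 4) :
    ∃ q : ℕ → ℝ,
      JunctionEigen n m a ((∑ i ∈ Finset.Icc 1 (n + m), a i) / ((n : ℝ) + (m : ℝ))) q := by
  have hN : (0 : ℝ) < (n : ℝ) + (m : ℝ) := by positivity
  refine ⟨_, junctionEigen_freeProfile (by omega) (by omega) a ?_ ?_⟩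
  · rw [Finset.sum_sub_distrib, Finset.sum_const, Nat.card_Icc, nsmul_eq_mul,
      Nat.add_sub_cancel, Nat.cast_add, mul_div_cancel₀ _ hN.ne', sub_self]
  · rw [div_le_iff₀ hN]
    linarith
end

section
/- Freeze phase of the full junction: let s = ∑_{i=1}^{n+m} a_i be the total number of cars and assume s ≥ m (equivalently the density d = s/(n+m−1) satisfies d ≥ γ = r/(1−ρ) with r = m/(n+m), ρ = 1/(n+m)). Then λ = 0 is an eigenvalue of the junction eigenvalue problem: there exists q ∈ ℝ^{n+m} such that (0, q) solves the junction eigenvalue problem; in this phase no vehicle can move. -/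
/-- A sequence with increments at most `1` on `[i, j)` grows by at most `j - i` there. -/
theorem sub_le_natCast_sub_of_increment_le_one {A a : ℕ → ℝ} (hA : ∀ k, A (k + 1) = A k + a k)
    {i j : ℕ} (hij : i ≤ j) (h : ∀ k, i ≤ k → k < j → a k ≤ 1) : A j - A i ≤ (j : ℝ) - i := by
  induction j, hij using Nat.le_induction with
  | base => simp
  | succ j hij ih =>
    have h₁ := ih fun k hk hkj => h k hk (by omega)
    have h₂ := h j hij (by omega)
    rw [hA]
    push_cast
    linarith

/-- freeze phase of the full junction: if the total number of
cars `s = ∑_{i=1}^{n+m} a_i` satisfies `s ≥ m`, then `λ = 0` is an eigenvalue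
of the junction eigenvalue problem. -/
theorem junction_eigen_freeze_phase (n m : ℕ) (hn : 3 ≤ n) (hm : 3 ≤ m)
    (a : ℕ → ℝ) (ha : ∀ i, 1 ≤ i → i ≤ n + m → 0 ≤ a i ∧ a i ≤ 1)
    (hjunc : a n + a (n + m) ≤ 1)
    (hs : (m : ℝ) ≤ ∑ i ∈ Finset.Icc 1 (n + m), a i) :
    ∃ q : ℕ → ℝ, JunctionEigen n m a 0 q := by
  obtain ⟨A, hA, hsum⟩ : ∃ A : ℕ → ℝ, (∀ k, A (k + 1) = A k + a k) ∧
      ∑ i ∈ Finset.Icc 1 (n + m), a i = A (n + m + 1) - A 1 :=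
    ⟨fun k => ∑ i ∈ Finset.range k, a i, fun k => Finset.sum_range_succ a k, by
      rw [← Finset.sum_Ico_eq_sub a (by omega : 1 ≤ n + m + 1)]; rfl⟩
  have hpred : ∀ i, 1 ≤ i → A i = A (i - 1) + a (i - 1) := fun i hi => by
    rw [← hA, Nat.sub_add_cancel hi]
  have hcast : ∀ i : ℕ, 1 ≤ i → ((i - 1 : ℕ) : ℝ) = i - 1 := fun i hi => by
    rw [Nat.cast_sub hi, Nat.cast_one]
  rw [hsum, hA] at hs
  have hAn := hA n
  have hfirst : A n - A 1 ≤ (n : ℝ) - (1 : ℕ) :=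
    sub_le_natCast_sub_of_increment_le_one hA (by omega)
      fun k h₁ h₂ => (ha k h₁ (by omega)).2
  have hsecond : A (n + m) - A (n + 1) ≤ ((n + m : ℕ) : ℝ) - (n + 1 : ℕ) :=
    sub_le_natCast_sub_of_increment_le_one hA (by omega)
      fun k h₁ h₂ => (ha k (by omega) (by omega)).2
  push_cast at hfirst hsecond
  -- `t` will be `(q n + q (n + m)) / 2`, under the normalization `q (n + m) = 0`.
  obtain ⟨t, ht⟩ : ∃ t : ℝ, t = m - a (n + m) - (A (n + m) - A (n + 1)) := ⟨_, rfl⟩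
  obtain ⟨q, hq⟩ : ∃ q : ℕ → ℝ, q = fun i =>
    if i ≤ n then min (a n + t + (A i - A 1)) (2 * t + (n - i) - (A n - A i))
    else (n + m - i) - (A (n + m) - A i) := ⟨_, rfl⟩
  have hq₁ : ∀ i, i ≤ n →
      q i = min (a n + t + (A i - A 1)) (2 * t + (n - i) - (A n - A i)) :=
    fun i hi => by simp [hq, hi]
  have hq₂ : ∀ i, n < i → q i = (n + m - i) - (A (n + m) - A i) :=
    fun i hi => by simp [hq, Nat.not_le.mpr hi]
  have hq_one : q 1 = a n + t := by
    rw [hq₁ 1 (by omega), min_eq_left] <;> push_cast <;> linarith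
  have hq_n : q n = 2 * t := by
    rw [hq₁ n le_rfl, min_eq_right] <;> linarith
  have hq_nm : q (n + m) = 0 := by
    rw [hq₂ _ (by omega)]; push_cast; ring
  have hq_succ : q (n + 1) = t + a (n + m) - 1 := by
    rw [hq₂ _ (by omega)]; push_cast; linarith
  refine ⟨q, ?_, ?_, ?_, ?_, ?_⟩
  · intro i hi₁ hi₂ hin hin'
    have h₁ := hA i
    have h₂ := hpred i (by omega)
    have h₃ := hcast i (by omega)
    rcases Nat.lt_or_gt_of_ne hin with h | h
    · rw [hq₁ i (by omega), hq₁ (i - 1) (by omega), hq₁ (i + 1) (by omega), h₃]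
      push_cast
      grind
    · rw [hq₂ i h, hq₂ (i - 1) (by omega), hq₂ (i + 1) (by omega), h₃, min_eq_right] <;>
        push_cast <;> linarith
  · have h₂ := hpred n (by omega)
    have h₃ := hcast n (by omega)
    rw [hq_n, hq_nm, hq_one, hq_succ, min_eq_left]
    · ring
    · rw [hq₁ (n - 1) (by omega), h₃]
      grind
  · have h₂ := hpred (n + m) (by omega)
    have h₃ := hcast (n + m) (by omega)
    rw [hq_n, hq_nm, hq_one, hq_succ, hq₂ (n + m - 1) (by omega), h₃, min_eq_left] <;>
      push_cast <;> linarith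
  · have h₁ := hA 1
    have h₂ : a n + t ≤ 1 - a 1 + q 2 := by
      rw [hq₁ 2 (by omega)]
      have h₃ : A 2 = A 1 + a 1 := h₁
      push_cast
      grind
    rw [hq_n, hq_nm, hq_one, min_eq_left] <;> linarith
  · have h₁ : A (n + 2) = A (n + 1) + a (n + 1) := hA (n + 1)
    rw [hq_n, hq_nm, hq_succ, hq₂ (n + 2) (by omega), min_eq_right] <;>
      push_cast <;> linarith
end
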